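/- arXiv:2303.06802 — 3 statements merged into one kernel-verified Lean document; each statement's English description precedes it below -/
import Mathlib

section
/- Let X be an affine source over {0,1}^n with entropy n−r, and write X = X₁∘⋯∘X_t as a concatenation of t blocks where block X_i has n_i bits and Σ_{i=1}^t n_i = n. Then the distribution of X is a convex combination of distributions X^j = X^j₁∘⋯∘X^j_t (i.e., there exist finitely many indices j with weights p_j ≥ 0 summing to 1 such that Pr[X = x] = Σ_j p_j · Pr[X^j = x] for all x) such that for each j the blocks X^j₁,…,X^j_t are mutually independent affine sources, and for each j and each i ∈ [t] the block X^j_i has entropy at least n_i − r. -/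
open scoped ENNReal

/-- The uniform distribution over the affine subspace (coset) `v + W`. -/
noncomputable def uniformCoset {V : Type*} [AddCommGroup V] [Module (ZMod 2) V] [Finite V]
    (W : Submodule (ZMod 2) V) (v : V) : PMF V :=
  letI : Fintype W := Fintype.ofFinite W
  letI : Nonempty W := ⟨0⟩
  PMF.map (fun w => v + (w : V)) (PMF.uniformOfFintype W)

theorem uniformCoset_apply {V : Type*} [AddCommGroup V] [Module (ZMod 2) V] [Finite V]
    (W : Submodule (ZMod 2) V) (v x : V) [Decidable (x - v ∈ W)] :
    uniformCoset W v x = if x - v ∈ W then (Nat.card W : ℝ≥0∞)⁻¹ else 0 := by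
  classical
  let : Fintype W := Fintype.ofFinite W
  have : Nonempty W := ⟨0⟩
  have key : uniformCoset W v x = ∑ a : W, if x = v + a then (Fintype.card W : ℝ≥0∞)⁻¹ else 0 := by
    rw [← tsum_fintype (L := .unconditional _)]
    have hmap : uniformCoset W v =
        (PMF.uniformOfFintype W).map (fun w : W => v + (w : V)) := by
      change ((PMF.uniformOfFintype W).map (fun w : W => (w : V))).map (fun w => v + w) = _
      rw [PMF.map_comp]
      rfl
    simp only [hmap, PMF.map_apply, PMF.uniformOfFintype_apply]
  rw [key, Nat.card_eq_fintype_card]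
  split_ifs with h
  · rw [Finset.sum_eq_single (⟨x - v, h⟩ : W)]
    · simp
    · rintro b - hb
      refine if_neg fun hx => hb (Subtype.ext ?_)
      simp [hx]
    · simp
  · refine Finset.sum_eq_zero fun a _ => if_neg fun hx => h ?_
    simp [hx]

theorem uniformCoset_apply_eq_sub {V : Type*} [AddCommGroup V] [Module (ZMod 2) V] [Finite V]
    (W : Submodule (ZMod 2) V) (v x : V) :
    uniformCoset W v x = uniformCoset W 0 (x - v) := by
  classical
  simp [uniformCoset_apply]

theorem Submodule.mem_of_forall_mem_comap_single {R ι : Type*} [Semiring R] [Fintype ι]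
    [DecidableEq ι] {M : ι → Type*} [∀ i, AddCommMonoid (M i)] [∀ i, Module R (M i)]
    (W : Submodule R (∀ i, M i)) {y : ∀ i, M i}
    (h : ∀ i, y i ∈ W.comap (LinearMap.single R M i)) : y ∈ W := by
  rw [← Finset.univ_sum_single y]
  exact W.sum_mem fun i _ => h i

theorem Submodule.finrank_add_finrank_le_finrank_comap_add {K V E : Type*} [DivisionRing K]
    [AddCommGroup V] [Module K V] [AddCommGroup E] [Module K E] [FiniteDimensional K E]
    (W : Submodule K E) {f : V →ₗ[K] E} (hf : Function.Injective f) :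
    Module.finrank K W + Module.finrank K V ≤
      Module.finrank K (W.comap f) + Module.finrank K E := by
  have hsum := Submodule.finrank_sup_add_finrank_inf_eq W (LinearMap.range f)
  have hle := Submodule.finrank_le (W ⊔ LinearMap.range f)
  have hmap := (LinearEquiv.finrank_eq (Submodule.equivMapOfInjective f hf (W.comap f)))
  rw [Submodule.map_comap_eq, inf_comm] at hmap
  rw [LinearMap.finrank_range_of_inj hf] at hsum
  omega

theorem sum_prod_uniformCoset_comap_single {ι : Type*} [Fintype ι] [DecidableEq ι]
    {M : ι → Type*} [∀ i, AddCommGroup (M i)] [∀ i, Module (ZMod 2) (M i)] [∀ i, Finite (M i)]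
    (W : Submodule (ZMod 2) (∀ i, M i)) [Fintype W] :
    ∑ y : W, ∏ i, uniformCoset (W.comap (LinearMap.single (ZMod 2) M i)) 0 (y.1 i) = 1 := by
  classical
  have : ∀ i, Fintype (M i) := fun i => Fintype.ofFinite _
  let g : (∀ i, M i) → ℝ≥0∞ :=
    fun y => ∏ i, uniformCoset (W.comap (LinearMap.single (ZMod 2) M i)) 0 (y i)
  have hg : ∀ y, y ∉ W → g y = 0 := fun y hy => by
    obtain ⟨i, hi⟩ : ∃ i, y i ∉ W.comap (LinearMap.single (ZMod 2) M i) := by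
      by_contra! h
      exact hy (W.mem_of_forall_mem_comap_single h)
    exact Finset.prod_eq_zero (Finset.mem_univ i) (by rw [uniformCoset_apply, sub_zero, if_neg hi])
  calc ∑ y : W, g y = ∑ y, g y := by
        rw [← Finset.sum_subset (Finset.subset_univ (Finset.univ.filter (· ∈ W)))
          (fun y _ hy => hg y (by simpa using hy))]
        exact (Finset.sum_subtype _ (by simp) g).symm
    _ = ∏ i, ∑ z, uniformCoset (W.comap (LinearMap.single (ZMod 2) M i)) 0 z :=
        (Fintype.prod_sum _).symm
    _ = 1 := Finset.prod_eq_one fun i _ => by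
        rw [← tsum_fintype (L := .unconditional _), PMF.tsum_coe]

theorem uniformCoset_apply_eq_sum_prod {ι : Type*} [Fintype ι] [DecidableEq ι]
    {M : ι → Type*} [∀ i, AddCommGroup (M i)] [∀ i, Module (ZMod 2) (M i)] [∀ i, Finite (M i)]
    (W : Submodule (ZMod 2) (∀ i, M i)) [Fintype W] (v x : ∀ i, M i) :
    uniformCoset W v x = ∑ u : W, (Nat.card W : ℝ≥0∞)⁻¹ *
      ∏ i, uniformCoset (W.comap (LinearMap.single (ZMod 2) M i)) ((v + u) i) (x i) := by
  classical
  rw [← Finset.mul_sum, uniformCoset_apply]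
  split_ifs with h
  · rw [← Equiv.sum_comp (Equiv.subLeft (⟨x - v, h⟩ : W))]
    have key : ∀ (u : W) (i : ι), x i - (v + (Equiv.subLeft (⟨x - v, h⟩ : W) u : ∀ i, M i)) i
        = u.1 i := fun u i => by
      simp only [Equiv.subLeft_apply, Submodule.coe_sub, Pi.add_apply, Pi.sub_apply]
      abel
    simp_rw [uniformCoset_apply_eq_sub _ _ (x _), key]
    rw [sum_prod_uniformCoset_comap_single, mul_one]
  · rw [Finset.sum_eq_zero, mul_zero]
    intro u _
    obtain ⟨i, hi⟩ : ∃ i, x i - (v + u.1) i ∉ W.comap (LinearMap.single (ZMod 2) M i) := by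
      by_contra! hall
      have hmem : x - (v + u.1) ∈ W := W.mem_of_forall_mem_comap_single hall
      exact h (by simpa [← sub_sub] using W.add_mem hmem u.2)
    exact Finset.prod_eq_zero (Finset.mem_univ i) (by rw [uniformCoset_apply, if_neg hi])

/-- Let `X` be an affine source over `{0,1}^n` with entropy `n - r`, written as a
concatenation of `t` blocks of sizes `n₁,…,n_t` with `Σᵢ nᵢ = n` (we model `{0,1}^n`,
partitioned into blocks, as the product `Π i, F₂^{nᵢ}`).  Then `X` is a convex
combination of distributions whose blocks are mutually independent affine sources, each
block of index `i` having entropy (dimension) at least `nᵢ - r`. -/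
theorem stmt_14 (t : ℕ) (nv : Fin t → ℕ) (n r : ℕ) (hn : n = ∑ i, nv i) (hr : r ≤ n)
    (W : Submodule (ZMod 2) (∀ i : Fin t, Fin (nv i) → ZMod 2))
    (hW : Module.finrank (ZMod 2) W = n - r)
    (v : ∀ i : Fin t, Fin (nv i) → ZMod 2) :
    ∃ (J : Type) (_ : Fintype J) (w : J → ℝ≥0∞)
      (q : J → ∀ i : Fin t, PMF (Fin (nv i) → ZMod 2)),
      (∑ j, w j) = 1 ∧
      (∀ j i, ∃ (Wi : Submodule (ZMod 2) (Fin (nv i) → ZMod 2))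
          (vi : Fin (nv i) → ZMod 2),
          (Module.finrank (ZMod 2) Wi : ℝ) ≥ (nv i : ℝ) - (r : ℝ) ∧
          q j i = uniformCoset Wi vi) ∧
      ∀ x : ∀ i : Fin t, Fin (nv i) → ZMod 2,
        (uniformCoset W v) x = ∑ j, w j * ∏ i, (q j i) (x i) := by
  classical
  let : Fintype W := Fintype.ofFinite W
  let Wi (i : Fin t) := W.comap (LinearMap.single (ZMod 2) (fun i => Fin (nv i) → ZMod 2) i)
  refine ⟨W, inferInstance, fun _ => (Nat.card W : ℝ≥0∞)⁻¹,
    fun u i => uniformCoset (Wi i) ((v + u.1) i), ?_,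
    fun u i => ⟨Wi i, (v + u.1) i, ?_, rfl⟩, fun x => uniformCoset_apply_eq_sum_prod W v x⟩
  · rw [Finset.sum_const, Finset.card_univ, nsmul_eq_mul, Nat.card_eq_fintype_card]
    exact ENNReal.mul_inv_cancel (by simp) (by simp)
  · have h := W.finrank_add_finrank_le_finrank_comap_add
      (f := LinearMap.single (ZMod 2) (fun i => Fin (nv i) → ZMod 2) i)
      (Pi.single_injective (M := fun i => Fin (nv i) → ZMod 2) i)
    have htotal : Module.finrank (ZMod 2) (∀ i : Fin t, Fin (nv i) → ZMod 2) = n := by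
      rw [Module.finrank_pi_fintype, hn]
      exact Finset.sum_congr rfl fun i _ => Module.finrank_fin_fun _
    rw [hW, htotal, Module.finrank_fin_fun] at h
    rw [ge_iff_le, sub_le_iff_le_add]
    norm_cast
    change nv i ≤ Module.finrank (ZMod 2) (W.comap (LinearMap.single (ZMod 2) _ i)) + r
    omega
end

section
/- Suppose there exist constants ℓ∈ℕ, γ>0, α>0, c>0 such that for every n∈ℕ there exists an ℓ-source non-malleable extractor nmExt : ({0,1}^n)^ℓ → {0,1}^{m(n)} for min-entropy (1−γ)n with output length m(n) ≥ α·n and error at most 2^{−cn}. Then there exist constants β>0 and c'>0 such that for every n∈ℕ divisible by ℓ there exists a ((1−β)n, β·(n/ℓ), 2^{−c'n}) non-malleable somewhere condenser with advice advSRcond : {0,1}^n × {0,1}^{⌊βn⌋} → ({0,1}^{n/ℓ})^{ℓ+1}. (Explicitness/efficient computability is omitted in both hypothesis and conclusion.) -/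
open scoped ENNReal

/-- `Bits n` is the set of `n`-bit strings `{0,1}^n`. -/
abbrev Bits (n : ℕ) : Type := Fin n → Bool

/-- Statistical distance `Δ(p,q) = max_{T ⊆ S} |p(T) - q(T)|`. -/
noncomputable def sd {α : Type*} [Fintype α] (p q : PMF α) : ℝ :=
  ⨆ T : Finset α, |∑ x ∈ T, (p x).toReal - ∑ x ∈ T, (q x).toReal|

/-- `X` has min-entropy at least `k`, i.e. `Pr[X = x] ≤ 2^{-k}` for all `x`. -/
def minEntropyGe {α : Type*} (p : PMF α) (k : ℝ) : Prop :=
  ∀ x, (p x).toReal ≤ (2 : ℝ) ^ (-k)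

/-- Joint distribution of two independent random variables. -/
noncomputable def prodPMF {α β : Type*} (p : PMF α) (q : PMF β) : PMF (α × β) :=
  p.bind fun x => q.map fun y => (x, y)

open Classical in
/-- The probability that a sample from `p` satisfies `φ`. -/
noncomputable def pr {α : Type*} [Fintype α] (p : PMF α) (φ : α → Prop) : ℝ≥0∞ :=
  ∑ x : α, if φ x then p x else 0

/-- `nmExt` is an `ℓ`-source non-malleable extractor for min-entropy `k` with error `ε`:
for all independent `(n,k)`-sources `X₁,…,X_ℓ` (whose joint distribution `P` is the
product of the marginals `pX i`) and tampering functions `f₁,…,f_ℓ` such that some `fᵢ`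
has no fixed points,
`Δ((nmExt(X₁,…,X_ℓ), nmExt(f₁(X₁),…,f_ℓ(X_ℓ))), (U_m, nmExt(f₁(X₁),…,f_ℓ(X_ℓ)))) ≤ ε`. -/
def IsLSourceNMExt {ℓ n m : ℕ} (k ε : ℝ) (nmExt : (Fin ℓ → Bits n) → Bits m) : Prop :=
  ∀ (P : PMF (Fin ℓ → Bits n)) (pX : Fin ℓ → PMF (Bits n)),
    (∀ x, P x = ∏ i, pX i (x i)) →
    (∀ i, minEntropyGe (pX i) k) →
    ∀ f : Fin ℓ → Bits n → Bits n, (∃ i, ∀ x, f i x ≠ x) →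
      sd (P.map fun x => (nmExt x, nmExt fun i => f i (x i)))
         (prodPMF (PMF.uniformOfFintype (Bits m))
           (P.map fun x => nmExt fun i => f i (x i))) ≤ ε

/-- A pair `(Z, Z')` of `t × m` somewhere-random-style matrices has the non-malleable
somewhere property for `k'`: there exists a row `j` such that for every value `z` of
`Z'_j`, the conditional distribution of `Z_j` given `Z'_j = z` is a `k'`-source. -/
def NMSomewhereProperty {m t : ℕ} (k' : ℝ)
    (Q : PMF ((Fin t → Bits m) × (Fin t → Bits m))) : Prop :=
  ∃ j : Fin t, ∀ z x : Bits m,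
    (pr Q fun zz => zz.1 j = x ∧ zz.2 j = z).toReal ≤
      (2 : ℝ) ^ (-k') * (pr Q fun zz => zz.2 j = z).toReal

/-- `F` is a `(k, k', ε)` non-malleable somewhere condenser with advice: for all jointly
distributed `X, X'` (joint distribution `P`) with `H∞(X) ≥ k` and all distinct advice
strings `α ≠ α'`, the pair `(F(X,α), F(X',α'))` is `ε`-close to a convex combination of
pairs of random variables each satisfying the non-malleable somewhere property. -/
def IsNMSomewhereCondenser {n a m t : ℕ} (k k' ε : ℝ)
    (F : Bits n → Bits a → Fin t → Bits m) : Prop :=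
  ∀ P : PMF (Bits n × Bits n), minEntropyGe (P.map Prod.fst) k →
    ∀ αa αb : Bits a, αa ≠ αb →
      ∃ (J : Type) (wp : PMF J)
        (Q : J → PMF ((Fin t → Bits m) × (Fin t → Bits m))),
        (∀ j ∈ wp.support, NMSomewhereProperty k' (Q j)) ∧
        sd (P.map fun xx => (F xx.1 αa, F xx.2 αb)) (wp.bind Q) ≤ ε

section Condenser

open Finset

theorem exists_maximal_split {Ω J B : Type*} [Fintype Ω] [Fintype J] [Fintype B]
    [DecidableEq Ω] [DecidableEq J] [DecidableEq B] (P : Ω → ℝ) (hP : ∀ ω, 0 ≤ P ω)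
    (u v : J → Ω → B) (K : ℝ) (hK : 0 < K) :
    ∃ q : J → Ω → ℝ, (∀ j ω, 0 ≤ q j ω) ∧ (∀ ω, ∑ j, q j ω ≤ P ω) ∧
      (∀ j x z, K * (∑ ω with u j ω = x ∧ v j ω = z, q j ω) ≤ ∑ ω with v j ω = z, q j ω) ∧
      ∀ j z, ∃ L : Finset B, (#L : ℝ) ≤ K ∧
        ∀ ω, v j ω = z → ∑ i, q i ω < P ω → u j ω ∈ L := by
  classical
  let C : Set (J → Ω → ℝ) := {q | (∀ j ω, 0 ≤ q j ω) ∧ (∀ ω, ∑ j, q j ω ≤ P ω) ∧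
      ∀ j x z, K * (∑ ω with u j ω = x ∧ v j ω = z, q j ω) ≤ ∑ ω with v j ω = z, q j ω}
  have hclosed : IsClosed C := by
    simp only [C, Set.ofPred_and, Set.ofPred_forall]
    refine IsClosed.inter ?_ (IsClosed.inter ?_ ?_)
    · exact isClosed_iInter fun j => isClosed_iInter fun ω =>
        isClosed_le (by fun_prop) (by fun_prop)
    · exact isClosed_iInter fun ω => isClosed_le (by fun_prop) (by fun_prop)
    · exact isClosed_iInter fun j => isClosed_iInter fun x => isClosed_iInter fun z =>
        isClosed_le (by fun_prop) (by fun_prop)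
  have hcompact : IsCompact C := by
    refine (isCompact_Icc (a := (0 : J → Ω → ℝ)) (b := fun _ ω => P ω)).of_isClosed_subset
      hclosed ?_
    rintro q ⟨h0, h1, -⟩
    refine ⟨fun j ω => h0 j ω, fun j ω => le_trans ?_ (h1 ω)⟩
    exact single_le_sum (f := fun j => q j ω) (fun i _ => h0 i ω) (mem_univ j)
  have hne : C.Nonempty := ⟨0, by simp, by simpa using hP, by simp⟩
  obtain ⟨q, ⟨h0, h1, h2⟩, hmax⟩ := hcompact.exists_isMaxOn hne
    (f := fun q => ∑ j, ∑ ω, q j ω) (by fun_prop)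
  refine ⟨q, h0, h1, h2, fun j z => ?_⟩
  refine ⟨univ.filter fun x => ∃ ω, u j ω = x ∧ v j ω = z ∧ ∑ i, q i ω < P ω, ?_,
    fun ω hz hlt => by simpa using ⟨ω, rfl, hz, hlt⟩⟩
  by_contra! hcard
  set S := univ.filter fun x => ∃ ω, u j ω = x ∧ v j ω = z ∧ ∑ i, q i ω < P ω with hS
  have hpick : ∀ x : S, ∃ ω, u j ω = x ∧ v j ω = z ∧ ∑ i, q i ω < P ω := by
    rintro ⟨x, hx⟩
    simpa [hS] using hx
  choose pick hu hv hlt using hpick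
  have hinj : Function.Injective pick := fun x y hxy => by
    apply Subtype.ext
    rw [← hu x, ← hu y, hxy]
  set T : Finset Ω := univ.image pick with hT
  have hTcard : #T = #S := by
    rw [hT, card_image_of_injective _ hinj, card_univ, Fintype.card_coe]
  have hSpos : 0 < #S := by exact_mod_cast hK.trans hcard
  have hTne : T.Nonempty := card_pos.mp (hTcard ▸ hSpos)
  obtain ⟨ω₀, hω₀, hmin⟩ := T.exists_min_image (fun ω => P ω - ∑ i, q i ω) hTne
  set η := P ω₀ - ∑ i, q i ω₀ with hη
  have hTmem : ∀ ω ∈ T, v j ω = z ∧ ∑ i, q i ω < P ω := by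
    intro ω hω
    obtain ⟨x, -, rfl⟩ := mem_image.mp hω
    exact ⟨hv x, hlt x⟩
  have hTinj : ∀ ω ∈ T, ∀ ω' ∈ T, u j ω = u j ω' → ω = ω' := by
    intro ω hω ω' hω' h
    obtain ⟨x, -, rfl⟩ := mem_image.mp hω
    obtain ⟨y, -, rfl⟩ := mem_image.mp hω'
    rw [hu, hu] at h
    rw [Subtype.ext h]
  have hηpos : 0 < η := sub_pos.mpr (hTmem ω₀ hω₀).2
  let h : Ω → ℝ := fun ω => if ω ∈ T then η else 0
  have hh0 : ∀ ω, 0 ≤ h ω := fun ω => by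
    simp only [h]; split_ifs <;> [exact hηpos.le; exact le_rfl]
  let q' : J → Ω → ℝ := fun i ω => q i ω + if i = j then h ω else 0
  have hq' : q' ∈ C := by
    refine ⟨fun i ω => ?_, fun ω => ?_, fun i x z' => ?_⟩
    · have := h0 i ω
      have := hh0 ω
      simp only [q']; split_ifs <;> linarith
    · simp only [q', sum_add_distrib, sum_ite_eq', mem_univ, if_true, h]
      split_ifs with hω
      · have := hmin ω hω
        linarith
      · simpa using h1 ω
    · simp only [q', sum_add_distrib, mul_add]
      refine add_le_add (h2 i x z') ?_
      by_cases hij : i = j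
      swap
      · simp [hij]
      subst hij
      simp only [if_true]
      by_cases hz : z' = z
      · subst hz
        have e1 : ∑ ω with v i ω = z', h ω = η * #T := by
          simp only [h]
          rw [← sum_filter, sum_const, nsmul_eq_mul, mul_comm]
          congr 3
          ext ω
          simpa using fun hω => (hTmem ω hω).1
        have e2 : ∑ ω with u i ω = x ∧ v i ω = z', h ω ≤ η := by
          simp only [h]
          rw [← sum_filter, sum_const, nsmul_eq_mul]
          have : #{ω ∈ {ω | u i ω = x ∧ v i ω = z'} | ω ∈ T} ≤ 1 := by
            rw [card_le_one]
            intro a ha b hb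
            simp only [mem_filter, mem_univ, true_and] at ha hb
            exact hTinj a ha.2 b hb.2 (ha.1.1.trans hb.1.1.symm)
          have : (#{ω ∈ {ω | u i ω = x ∧ v i ω = z'} | ω ∈ T} : ℝ) ≤ 1 := by exact_mod_cast this
          nlinarith
        rw [e1, hTcard]
        nlinarith
      · have e2 : ∑ ω with u i ω = x ∧ v i ω = z', h ω = 0 := by
          refine sum_eq_zero fun ω hω => ?_
          simp only [mem_filter, mem_univ, true_and] at hω
          simp only [h]
          rw [if_neg]
          exact fun hωT => hz (hω.2.symm.trans (hTmem ω hωT).1)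
        rw [e2, mul_zero]
        exact sum_nonneg fun ω _ => hh0 ω
  have hle := hmax hq'
  simp only [Set.mem_ofPred_eq, q', sum_add_distrib] at hle
  have e3 : ∑ i, ∑ ω, (if i = j then h ω else 0) = ∑ ω, h ω := by
    rw [sum_comm]; simp
  have e4 : 0 < ∑ ω, h ω :=
    sum_pos' (fun ω _ => hh0 ω) ⟨ω₀, mem_univ _, by simpa [h, hω₀] using hηpos⟩
  linarith

theorem card_exists_related_le {V B : Type*} [Fintype V] [DecidableEq V] [Nonempty V]
    {ℓ : ℕ} (E E' : (Fin ℓ → V) → B) (L : Fin ℓ → V → Finset V) (M : B → Finset B)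
    (K δ : ℝ) (hL : ∀ i z, (#(L i z) : ℝ) ≤ K) (D : ℕ) (hD : 0 < D)
    (hE : ∀ g : Fin ℓ → V → V,
      (Set.ncard {x | E x ∈ M (E' fun i => g i (x i))} : ℝ) ≤ (Fintype.card V : ℝ) ^ ℓ * δ) :
    (Set.ncard {x | ∃ x', (∀ i, x i ∈ L i (x' i)) ∧ E x ∈ M (E' x')} : ℝ) ≤
      (Fintype.card V : ℝ) ^ ℓ * (ℓ * (K / D) + D ^ ℓ * δ) := by
  classical
  let nb : Fin ℓ → V → Finset V := fun i v => univ.filter fun v' => v ∈ L i v'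
  let bad : Fin ℓ → Finset V := fun i => univ.filter fun v => D < #(nb i v)
  have hV : (0 : ℝ) < Fintype.card V := by exact_mod_cast Fintype.card_pos
  have hD' : (0 : ℝ) < D := by exact_mod_cast hD
  have hbad : ∀ i, (#(bad i) : ℝ) ≤ Fintype.card V * (K / D) := by
    intro i
    have h1 : #(bad i) * D ≤ ∑ v, #(nb i v) := by
      rw [← smul_eq_mul, ← sum_const]
      calc ∑ _v ∈ bad i, D ≤ ∑ v ∈ bad i, #(nb i v) :=
            sum_le_sum fun v hv => (mem_filter.mp hv).2.le
        _ ≤ _ := sum_le_sum_of_subset (subset_univ _)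
    have h2 : ∑ v, #(nb i v) = ∑ z, #(L i z) := by
      have := sum_card_bipartiteAbove_eq_sum_card_bipartiteBelow (s := univ) (t := univ)
        (fun v v' : V => v ∈ L i v')
      simpa [bipartiteAbove, bipartiteBelow, nb] using this
    have h3 : ((∑ z, #(L i z) : ℕ) : ℝ) ≤ Fintype.card V * K := by
      push_cast
      calc ∑ z, (#(L i z) : ℝ) ≤ ∑ _z : V, K := sum_le_sum fun z _ => hL i z
        _ = _ := by simp
    rw [← mul_div_assoc, le_div_iff₀ hD']
    refine le_trans ?_ h3
    rw [← h2]
    exact_mod_cast h1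
  have hφ : ∀ i v, ∃ φ : Fin D → V, v ∉ bad i → ∀ v' ∈ nb i v, ∃ a, φ a = v' := by
    intro i v
    by_cases hv : v ∈ bad i
    · exact ⟨fun _ => v, fun h => absurd hv h⟩
    have hc : #(nb i v) ≤ D := by simpa [bad] using hv
    let eq := (nb i v).equivFin
    refine ⟨fun a => if h : (a : ℕ) < #(nb i v) then (eq.symm ⟨a, h⟩ : V) else v,
      fun _ v' hv' => ⟨⟨eq ⟨v', hv'⟩, (eq ⟨v', hv'⟩).2.trans_le hc⟩, ?_⟩⟩
    simp
  choose φ hφ using hφ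
  let badset : Fin ℓ → Finset (Fin ℓ → V) := fun i =>
    Fintype.piFinset (Function.update (fun _ => univ) i (bad i))
  let good : (Fin ℓ → Fin D) → Finset (Fin ℓ → V) := fun a =>
    univ.filter fun x => E x ∈ M (E' fun i => φ i (x i) (a i))
  have hbadset : ∀ i, (#(badset i) : ℝ) ≤ (Fintype.card V : ℝ) ^ ℓ * (K / D) := by
    intro i
    have e : (#(badset i) : ℝ) * Fintype.card V = #(bad i) * (Fintype.card V : ℝ) ^ ℓ := by
      have : #(badset i) * Fintype.card V = #(bad i) * (Fintype.card V) ^ ℓ := by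
        have h1 : ∀ k, #(Function.update (fun _ => univ) i (bad i) k : Finset V) =
            Function.update (fun _ => Fintype.card V) i #(bad i) k := by
          intro k
          by_cases h : k = i
          · subst h; simp
          · simp [h]
        rw [Fintype.card_piFinset]
        simp only [h1]
        rw [prod_update_of_mem (mem_univ i), mul_assoc]
        congr 1
        rw [prod_const, ← pow_succ]
        congr 1
        have : 0 < ℓ := i.pos
        simp [card_sdiff]
        omega
      exact_mod_cast this
    have := hbad i
    have h2 : (#(badset i) : ℝ) * Fintype.card V ≤
        ((Fintype.card V : ℝ) ^ ℓ * (K / D)) * Fintype.card V := by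
      rw [e]
      have : (0 : ℝ) ≤ (Fintype.card V : ℝ) ^ ℓ := by positivity
      nlinarith
    exact le_of_mul_le_mul_right h2 hV
  have hgood : ∀ a, (#(good a) : ℝ) ≤ (Fintype.card V : ℝ) ^ ℓ * δ := by
    intro a
    have := hE fun i v => φ i v (a i)
    rw [Set.ncard_eq_toFinset_card'] at this
    convert this using 3
    ext x
    simp [good]
  have hsub : {x | ∃ x', (∀ i, x i ∈ L i (x' i)) ∧ E x ∈ M (E' x')} ⊆
      ((univ.biUnion badset ∪ univ.biUnion good : Finset (Fin ℓ → V)) : Set (Fin ℓ → V)) := by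
    rintro x ⟨x', hx, hM⟩
    rw [mem_coe, mem_union]
    by_cases hb : ∃ i, x i ∈ bad i
    · obtain ⟨i, hi⟩ := hb
      left
      refine mem_biUnion.mpr ⟨i, mem_univ _, ?_⟩
      rw [Fintype.mem_piFinset]
      intro k
      by_cases h : k = i
      · subst h; simpa using hi
      · simp [h]
    · push Not at hb
      right
      have : ∀ i, ∃ a, φ i (x i) a = x' i := fun i =>
        hφ i (x i) (hb i) (x' i) (by simpa [nb] using hx i)
      choose a ha using this
      refine mem_biUnion.mpr ⟨a, mem_univ _, ?_⟩
      simpa [good, ha] using hM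
  calc (Set.ncard {x | ∃ x', (∀ i, x i ∈ L i (x' i)) ∧ E x ∈ M (E' x')} : ℝ)
      ≤ #(univ.biUnion badset ∪ univ.biUnion good) := by
        have := Set.ncard_le_ncard hsub (finite_toSet _)
        rw [Set.ncard_coe_finset] at this
        exact_mod_cast this
    _ ≤ (∑ i, #(badset i) + ∑ a, #(good a) : ℕ) := by
        exact_mod_cast (card_union_le _ _).trans (add_le_add card_biUnion_le card_biUnion_le)
    _ ≤ ∑ _i : Fin ℓ, (Fintype.card V : ℝ) ^ ℓ * (K / D) +
          ∑ _a : Fin ℓ → Fin D, (Fintype.card V : ℝ) ^ ℓ * δ := by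
        push_cast
        exact add_le_add (sum_le_sum fun i _ => hbadset i) (sum_le_sum fun a _ => hgood a)
    _ = _ := by
        simp
        ring

theorem PMF.sum_toReal_eq_one {α : Type*} [Fintype α] (p : PMF α) :
    ∑ x, (p x).toReal = 1 := by
  rw [← ENNReal.toReal_sum fun x _ => p.apply_ne_top x, ← tsum_fintype (L := .unconditional α),
    p.tsum_coe, ENNReal.toReal_one]

theorem PMF.map_apply_of_injective {α β : Type*} (p : PMF α) {f : α → β}
    (hf : Function.Injective f) (a : α) : p.map f (f a) = p a := by
  rw [PMF.map_apply, tsum_eq_single a]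
  · simp
  · intro b hb
    exact if_neg fun h => hb (hf h.symm)

theorem PMF.map_apply_eq_zero {α β : Type*} (p : PMF α) {f : α → β} {b : β}
    (hb : ∀ a, f a ≠ b) : p.map f b = 0 := by
  rw [PMF.map_apply]
  simp [fun a => (hb a).symm]

theorem PMF.sum_map_toReal {α β : Type*} [Fintype α] [DecidableEq β]
    (p : PMF α) (f : α → β) (T : Finset β) :
    ∑ y ∈ T, (p.map f y).toReal = ∑ x with f x ∈ T, (p x).toReal := by
  rw [← ENNReal.toReal_sum fun x _ => PMF.apply_ne_top _ x,
    ← ENNReal.toReal_sum fun x _ => PMF.apply_ne_top _ x,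
    ← PMF.toOuterMeasure_apply_finset, ← PMF.toOuterMeasure_apply_finset,
    PMF.toOuterMeasure_map_apply]
  congr 2
  ext x
  simp

theorem prodPMF_apply {α β : Type*} (p : PMF α) (q : PMF β) (x : α) (y : β) :
    prodPMF p q (x, y) = p x * q y := by
  rw [prodPMF, PMF.bind_apply, tsum_eq_single x]
  · rw [PMF.map_apply_of_injective q (f := fun y => (x, y)) (Prod.mk_right_injective x)]
  · intro a ha
    rw [PMF.map_apply_eq_zero, mul_zero]
    rintro b h
    exact ha (Prod.mk.inj h).1

theorem abs_sum_sub_sum_le_sd {α : Type*} [Fintype α] (p q : PMF α) (T : Finset α) :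
    |∑ x ∈ T, (p x).toReal - ∑ x ∈ T, (q x).toReal| ≤ sd p q :=
  le_ciSup (f := fun T : Finset α => |∑ x ∈ T, (p x).toReal - ∑ x ∈ T, (q x).toReal|)
    (Set.finite_range _).bddAbove T

theorem sd_le_one_sub_sum {α : Type*} [Fintype α] (p q : PMF α) (f : α → ℝ)
    (hp : ∀ x, f x ≤ (p x).toReal) (hq : ∀ x, f x ≤ (q x).toReal) :
    sd p q ≤ 1 - ∑ x, f x := by
  have key : ∀ (p q : PMF α), (∀ x, f x ≤ (p x).toReal) → (∀ x, f x ≤ (q x).toReal) →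
      ∀ T : Finset α, ∑ x ∈ T, (p x).toReal - ∑ x ∈ T, (q x).toReal ≤ 1 - ∑ x, f x := by
    intro p q hp hq T
    calc ∑ x ∈ T, (p x).toReal - ∑ x ∈ T, (q x).toReal
        ≤ ∑ x ∈ T, ((p x).toReal - f x) := by
          rw [sum_sub_distrib]
          exact sub_le_sub_left (sum_le_sum fun x _ => hq x) _
      _ ≤ ∑ x, ((p x).toReal - f x) :=
          sum_le_sum_of_subset_of_nonneg (subset_univ _) fun x _ _ => sub_nonneg.mpr (hp x)
      _ = _ := by rw [sum_sub_distrib, p.sum_toReal_eq_one]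
  refine ciSup_le fun T => abs_le.mpr ⟨?_, key p q hp hq T⟩
  have := key q p hq hp T
  linarith

theorem pr_toReal {α : Type*} [Fintype α] (p : PMF α) (φ : α → Prop) [DecidablePred φ] :
    (pr p φ).toReal = ∑ x with φ x, (p x).toReal := by
  rw [pr, ENNReal.toReal_sum, sum_filter]
  · refine sum_congr rfl fun x _ => ?_
    split_ifs <;> simp
  · intro x _
    split_ifs
    · exact p.apply_ne_top x
    · simp

theorem nmSomewhereProperty_map_const {m t : ℕ} {k : ℝ} (hk : k ≤ m) (j : Fin t) :
    NMSomewhereProperty k ((PMF.uniformOfFintype (Bits m)).map fun y =>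
      ((fun _ => y, fun _ _ => false) : (Fin t → Bits m) × (Fin t → Bits m))) := by
  classical
  refine ⟨j, fun z x => ?_⟩
  have h : ∀ φ : (Fin t → Bits m) × (Fin t → Bits m) → Prop, ∀ _ : DecidablePred φ,
      (pr ((PMF.uniformOfFintype (Bits m)).map fun y =>
      ((fun _ => y, fun _ _ => false) : (Fin t → Bits m) × (Fin t → Bits m))) φ).toReal =
      ∑ y : Bits m with φ (fun _ => y, fun _ _ => false),
        (PMF.uniformOfFintype (Bits m) y).toReal := by
    intro φ _
    rw [pr_toReal, PMF.sum_map_toReal]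
    simp
  rw [h _ inferInstance, h _ inferInstance]
  by_cases hz : (fun _ => false) = z
  swap
  · simp [hz]
  subst hz
  simp only [and_true]
  rw [filter_true, PMF.sum_toReal_eq_one, mul_one, sum_filter, sum_ite_eq' univ x]
  simp only [mem_univ, if_true, PMF.uniformOfFintype_apply, Fintype.card_pi, Fintype.card_bool,
    prod_const, card_univ, Fintype.card_fin, ENNReal.toReal_inv, ENNReal.toReal_natCast]
  push_cast
  rw [← Real.rpow_natCast, ← Real.rpow_neg (by norm_num)]
  exact Real.rpow_le_rpow_of_exponent_le (by norm_num) (by linarith)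

theorem exists_convex_combination_sd_le {m t : ℕ} {k : ℝ} (hk : k ≤ m) (j₀ : Fin t)
    (P : PMF ((Fin t → Bits m) × (Fin t → Bits m)))
    (q : Fin t → (Fin t → Bits m) × (Fin t → Bits m) → ℝ) (h0 : ∀ j ω, 0 ≤ q j ω)
    (h1 : ∀ ω, ∑ j, q j ω ≤ (P ω).toReal)
    (h2 : ∀ j x z, (2 : ℝ) ^ k * (∑ ω with ω.1 j = x ∧ ω.2 j = z, q j ω) ≤
      ∑ ω with ω.2 j = z, q j ω) :
    ∃ (J : Type) (wp : PMF J)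
        (Q : J → PMF ((Fin t → Bits m) × (Fin t → Bits m))),
        (∀ j ∈ wp.support, NMSomewhereProperty k (Q j)) ∧
        sd P (wp.bind Q) ≤ 1 - ∑ ω, ∑ j, q j ω := by
  classical
  let W : Fin t → ℝ := fun j => ∑ ω, q j ω
  have hW0 : ∀ j, 0 ≤ W j := fun j => sum_nonneg fun ω _ => h0 j ω
  have hW1 : ∑ j, W j ≤ 1 := by
    rw [← P.sum_toReal_eq_one, sum_comm]
    exact sum_le_sum fun ω _ => h1 ω
  let w : Option (Fin t) → ℝ := fun o => o.elim (1 - ∑ j, W j) W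
  have hw0 : ∀ o, 0 ≤ w o := by
    rintro (_ | j)
    · exact sub_nonneg.mpr hW1
    · exact hW0 j
  let wp : PMF (Option (Fin t)) := PMF.ofFintype (fun o => ENNReal.ofReal (w o)) (by
    rw [← ENNReal.ofReal_sum_of_nonneg fun o _ => hw0 o, Fintype.sum_option]
    simp [w])
  let Q₀ := (PMF.uniformOfFintype (Bits m)).map fun y =>
      ((fun _ => y, fun _ _ => false) : (Fin t → Bits m) × (Fin t → Bits m))
  have hQ : ∀ j, ∃ Q : PMF ((Fin t → Bits m) × (Fin t → Bits m)),
      NMSomewhereProperty k Q ∧ ∀ ω, q j ω ≤ W j * (Q ω).toReal := by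
    intro j
    rcases (hW0 j).eq_or_lt with hj | hj
    · refine ⟨Q₀, nmSomewhereProperty_map_const hk j₀, fun ω => ?_⟩
      rw [← hj, zero_mul]
      exact (single_le_sum (f := q j) (fun i _ => h0 j i) (mem_univ ω)).trans hj.ge
    have hq0 : ∀ ω, 0 ≤ q j ω / W j := fun ω => div_nonneg (h0 j ω) hj.le
    refine ⟨PMF.ofFintype (fun ω => ENNReal.ofReal (q j ω / W j)) ?_, ⟨j, fun z x => ?_⟩, ?_⟩
    · rw [← ENNReal.ofReal_sum_of_nonneg fun o _ => hq0 o, ← sum_div, div_self hj.ne',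
        ENNReal.ofReal_one]
    · rw [pr_toReal, pr_toReal]
      simp only [PMF.ofFintype_apply, ENNReal.toReal_ofReal (hq0 _)]
      rw [← sum_div, ← sum_div, Real.rpow_neg (by norm_num), ← mul_div_assoc]
      refine div_le_div_of_nonneg_right ?_ hj.le
      rw [inv_mul_eq_div, le_div_iff₀ (by positivity), mul_comm]
      exact h2 j x z
    · intro ω
      simp only [PMF.ofFintype_apply, ENNReal.toReal_ofReal (hq0 _)]
      rw [mul_div_cancel₀ _ hj.ne']
  choose Q hQ1 hQ2 using hQ
  refine ⟨Option (Fin t), wp, fun o => o.elim Q₀ Q, ?_, ?_⟩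
  · rintro (_ | j) -
    · exact nmSomewhereProperty_map_const hk j₀
    · exact hQ1 j
  · refine sd_le_one_sub_sum _ _ _ h1 fun ω => ?_
    rw [PMF.bind_apply, tsum_fintype, ENNReal.toReal_sum fun o _ =>
      ENNReal.mul_ne_top (PMF.apply_ne_top _ _) (PMF.apply_ne_top _ _), Fintype.sum_option]
    refine le_add_of_nonneg_of_le ENNReal.toReal_nonneg (sum_le_sum fun j _ => ?_)
    rw [ENNReal.toReal_mul]
    simpa [wp, w, ENNReal.toReal_ofReal (hW0 j)] using hQ2 j ω

theorem ncard_extractor_collision_le {ℓ N A M : ℕ} (hℓ : 0 < ℓ) {k ε δ : ℝ}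
    {nmExt : (Fin ℓ → Bits (N + A)) → Bits M} (hext : IsLSourceNMExt k ε nmExt) (hk : k ≤ N)
    {a b : Bits A} (hab : a ≠ b) {B : Type*} (conv : Bits M → B) (L : B → Finset B)
    (hconv : ∀ z, (Set.ncard {y | conv y ∈ L z} : ℝ) ≤ 2 ^ M * δ)
    (g : Fin ℓ → Bits N → Bits N) :
    (Set.ncard {x : Fin ℓ → Bits N | conv (nmExt fun i => Fin.append (x i) a) ∈
        L (conv (nmExt fun i => Fin.append (g i (x i)) b))} : ℝ) ≤
      (Fintype.card (Bits N) : ℝ) ^ ℓ * (ε + δ) := by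
  classical
  let app : Bits N → Bits (N + A) := fun v => Fin.append v a
  have happ : Function.Injective app := fun v w h => by
    ext i
    simpa [app] using congrFun h (Fin.castAdd A i)
  let apps : (Fin ℓ → Bits N) → (Fin ℓ → Bits (N + A)) := fun x i => app (x i)
  have happs : Function.Injective apps := fun v w h => by
    ext i : 1
    exact happ (congrFun h i)
  let f : Fin ℓ → Bits (N + A) → Bits (N + A) := fun i w =>
    Fin.append (g i fun r => w (Fin.castAdd A r))
      (if (fun r => w (Fin.natAdd N r)) = b then a else b)
  have hf : ∀ i w, f i w ≠ w := by
    intro i w h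
    have h' : (if (fun r => w (Fin.natAdd N r)) = b then a else b) =
        fun r => w (Fin.natAdd N r) := by
      ext r
      simpa [f] using congrFun h (Fin.natAdd N r)
    split_ifs at h' with hb
    · exact hab (h'.trans hb)
    · exact hb h'.symm
  have hfapp : ∀ i v, f i (app v) = Fin.append (g i v) b := by
    intro i v
    simp [f, app, hab]
  have hV : (0 : ℝ) < Fintype.card (Bits N) := by exact_mod_cast Fintype.card_pos
  let P := (PMF.uniformOfFintype (Fin ℓ → Bits N)).map apps
  let p := (PMF.uniformOfFintype (Bits N)).map app
  have hprod : ∀ x, P x = ∏ i, p (x i) := by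
    intro x
    by_cases hx : ∀ i, ∃ v, app v = x i
    · choose v hv using hx
      obtain rfl : apps v = x := funext hv
      simp only [P, p, apps, PMF.map_apply_of_injective _ happ]
      rw [PMF.map_apply_of_injective _ happs]
      simp [ENNReal.inv_pow]
    · push Not at hx
      obtain ⟨i, hi⟩ := hx
      have h0 : p (x i) = 0 := PMF.map_apply_eq_zero _ hi
      rw [prod_eq_zero (mem_univ i) h0]
      exact PMF.map_apply_eq_zero _ fun y h => hi (y i) (congrFun h i)
  have hent : minEntropyGe p k := by
    intro w
    by_cases hw : ∃ v, app v = w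
    · obtain ⟨v, rfl⟩ := hw
      simp only [p, PMF.map_apply_of_injective _ happ]
      simp only [PMF.uniformOfFintype_apply, Fintype.card_pi, Fintype.card_bool,
        prod_const, card_univ, Fintype.card_fin, ENNReal.toReal_inv, ENNReal.toReal_natCast]
      push_cast
      rw [← Real.rpow_natCast, ← Real.rpow_neg (by norm_num)]
      exact Real.rpow_le_rpow_of_exponent_le (by norm_num) (by linarith)
    · push Not at hw
      simp only [p, PMF.map_apply_eq_zero _ hw, ENNReal.toReal_zero]
      positivity
  let T : Finset (Bits M × Bits M) := univ.filter fun yz => conv yz.1 ∈ L (conv yz.2)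
  have hsd := (abs_le.mp ((abs_sum_sub_sum_le_sd _ _ T).trans
    (hext P (fun _ => p) hprod (fun _ => hent) f ⟨⟨0, hℓ⟩, hf _⟩))).2
  set q := P.map fun x => nmExt fun i => f i (x i)
  have hT : ∑ yz ∈ T, (prodPMF (PMF.uniformOfFintype (Bits M)) q yz).toReal ≤ δ := by
    have hM : (0 : ℝ) < 2 ^ M := by positivity
    calc ∑ yz ∈ T, (prodPMF (PMF.uniformOfFintype (Bits M)) q yz).toReal
        = ∑ z, (q z).toReal * ((Set.ncard {y | conv y ∈ L (conv z)} : ℝ) / 2 ^ M) := by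
          simp only [T]
          rw [sum_filter, Fintype.sum_prod_type_right]
          refine sum_congr rfl fun z _ => ?_
          rw [← sum_filter, Set.ncard_eq_toFinset_card']
          simp only [prodPMF_apply, ENNReal.toReal_mul, PMF.uniformOfFintype_apply]
          rw [sum_const, Set.toFinset_ofPred]
          simp
          ring
      _ ≤ ∑ z, (q z).toReal * δ := by
          refine sum_le_sum fun z _ => mul_le_mul_of_nonneg_left ?_ ENNReal.toReal_nonneg
          rw [div_le_iff₀ hM, mul_comm]
          exact hconv _
      _ = δ := by rw [← sum_mul, q.sum_toReal_eq_one, one_mul]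
  have hmass : ∑ yz ∈ T, (P.map (fun x => (nmExt x, nmExt fun i => f i (x i))) yz).toReal =
      (Set.ncard {x : Fin ℓ → Bits N | conv (nmExt fun i => Fin.append (x i) a) ∈
        L (conv (nmExt fun i => Fin.append (g i (x i)) b))} : ℝ) /
        (Fintype.card (Bits N) : ℝ) ^ ℓ := by
    simp only [P]
    rw [PMF.map_comp, PMF.sum_map_toReal, Set.ncard_eq_toFinset_card', Set.toFinset_ofPred]
    simp only [PMF.uniformOfFintype_apply]
    rw [sum_const]
    simp [T, apps, hfapp, app, div_eq_mul_inv]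
  rw [hmass] at hsd
  rw [mul_comm, ← div_le_iff₀ (by positivity)]
  linarith

/-- Truncate a bit string to length `N`, or pad it with `false`. -/
def resizeBits {M : ℕ} (N : ℕ) (y : Bits M) : Bits N :=
  fun i => if h : (i : ℕ) < M then y ⟨i, h⟩ else false

theorem ncard_resizeBits_eq_le {M N : ℕ} (w : Bits N) :
    Set.ncard {y : Bits M | resizeBits N y = w} ≤ 2 ^ (M - N) := by
  classical
  rw [Set.ncard_eq_toFinset_card']
  have : #(univ : Finset (Bits (M - N))) = 2 ^ (M - N) := by simp
  rw [← this]
  refine card_le_card_of_injOn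
    (fun y i => y ⟨N + i, by omega⟩) (fun _ _ => by simp) ?_
  intro y hy y' hy' h
  simp only [Set.coe_toFinset, Set.mem_ofPred_eq] at hy hy'
  ext i
  by_cases hi : (i : ℕ) < N
  · have := congrFun (hy.trans hy'.symm) ⟨i, hi⟩
    simpa [resizeBits] using this
  · have := congrFun h ⟨i - N, by omega⟩
    simpa [Nat.add_sub_cancel' (not_lt.mp hi)] using this

theorem ncard_resizeBits_mem_le {M N : ℕ} {K : ℝ} (S : Finset (Bits N)) (hS : (#S : ℝ) ≤ K) :
    (Set.ncard {y : Bits M | resizeBits N y ∈ S} : ℝ) ≤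
      2 ^ M * (K * 2 ^ (-((min M N : ℕ) : ℝ))) := by
  classical
  have h1 : Set.ncard {y : Bits M | resizeBits N y ∈ S} ≤ #S * 2 ^ (M - N) := by
    rw [Set.ncard_eq_toFinset_card', mul_comm]
    refine card_le_mul_card_image_of_maps_to (f := resizeBits N) (t := S) (by simp) _ ?_
    intro w _
    refine le_trans ?_ (ncard_resizeBits_eq_le (M := M) w)
    rw [Set.ncard_eq_toFinset_card']
    exact card_le_card fun y => by simp
  have h2 : (2 : ℝ) ^ M * 2 ^ (-((min M N : ℕ) : ℝ)) = 2 ^ (M - N) := by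
    rw [Real.rpow_neg (by norm_num), Real.rpow_natCast, ← div_eq_mul_inv, div_eq_iff (by positivity),
      ← pow_add]
    congr 1
    omega
  calc (Set.ncard {y : Bits M | resizeBits N y ∈ S} : ℝ) ≤ #S * 2 ^ (M - N) := by
        exact_mod_cast h1
    _ ≤ K * 2 ^ (M - N) := by gcongr
    _ = _ := by rw [← h2]; ring

/-- The blocks of the input, followed by the extractor applied to the blocks with the advice
appended to each of them. -/
def blocksAndExtractor {ℓ n N A M : ℕ} (e : Bits n ≃ (Fin ℓ → Bits N))
    (nmExt : (Fin ℓ → Bits (N + A)) → Bits M) (x : Bits n) (a : Bits A) :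
    Fin (ℓ + 1) → Bits N :=
  Fin.snoc (α := fun _ => Bits N) (e x) (resizeBits N (nmExt fun i => Fin.append (e x i) a))

theorem sd_blocksAndExtractor_le {ℓ n N A M D : ℕ} (hℓ : 0 < ℓ) (hD : 0 < D) {k ε κ k' : ℝ}
    {nmExt : (Fin ℓ → Bits (N + A)) → Bits M} (hext : IsLSourceNMExt k ε nmExt) (hk : k ≤ N)
    (hk' : k' ≤ N) (e : Bits n ≃ (Fin ℓ → Bits N)) (P : PMF (Bits n × Bits n))
    (hP : minEntropyGe (P.map Prod.fst) κ) {a b : Bits A} (hab : a ≠ b) :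
    ∃ (J : Type) (wp : PMF J)
        (Q : J → PMF ((Fin (ℓ + 1) → Bits N) × (Fin (ℓ + 1) → Bits N))),
        (∀ j ∈ wp.support, NMSomewhereProperty k' (Q j)) ∧
        sd (P.map fun xx => (blocksAndExtractor e nmExt xx.1 a, blocksAndExtractor e nmExt xx.2 b))
          (wp.bind Q) ≤ (2 : ℝ) ^ (-κ) * (((2 : ℝ) ^ N) ^ ℓ *
            (ℓ * ((2 : ℝ) ^ k' / D) +
              D ^ ℓ * (ε + (2 : ℝ) ^ k' * 2 ^ (-((min M N : ℕ) : ℝ))))) := by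
  classical
  set F : Bits n × Bits n → (Fin (ℓ + 1) → Bits N) × (Fin (ℓ + 1) → Bits N) := fun xx =>
    (blocksAndExtractor e nmExt xx.1 a, blocksAndExtractor e nmExt xx.2 b)
  obtain ⟨q, h0, h1, h2, h3⟩ := exists_maximal_split (fun ω => (P.map F ω).toReal)
    (fun _ => ENNReal.toReal_nonneg) (fun j ω => ω.1 j) (fun j ω => ω.2 j)
    ((2 : ℝ) ^ k') (by positivity)
  choose L hLcard hL using h3
  obtain ⟨J, wp, Q, hQ, hsd⟩ :=
    exists_convex_combination_sd_le hk' (Fin.last ℓ) (P.map F) q h0 h1 h2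
  refine ⟨J, wp, Q, hQ, hsd.trans ?_⟩
  set E : Bits A → (Fin ℓ → Bits N) → Bits N := fun c x =>
    resizeBits N (nmExt fun i => Fin.append (x i) c)
  set S : Set (Fin ℓ → Bits N) := {x | ∃ x' : Fin ℓ → Bits N,
    (∀ i : Fin ℓ, x i ∈ L i.castSucc (x' i)) ∧ E a x ∈ L (Fin.last ℓ) (E b x')}
  have hS := card_exists_related_le (E a) (E b) (fun i : Fin ℓ => L i.castSucc)
    (L (Fin.last ℓ)) ((2 : ℝ) ^ k') _ (fun i z => hLcard _ _) D hD
    (ncard_extractor_collision_le hℓ hext hk hab (resizeBits N) (L (Fin.last ℓ))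
      fun z => ncard_resizeBits_mem_le _ (hLcard _ _))
  have hmass : 1 - ∑ ω, ∑ j, q j ω ≤ (2 : ℝ) ^ (-κ) * S.ncard := by
    let G := univ.filter fun ω => ∑ j, q j ω < (P.map F ω).toReal
    calc 1 - ∑ ω, ∑ j, q j ω = ∑ ω, ((P.map F ω).toReal - ∑ j, q j ω) := by
          rw [sum_sub_distrib, PMF.sum_toReal_eq_one]
      _ ≤ ∑ ω, if ω ∈ G then (P.map F ω).toReal else 0 := by
          refine sum_le_sum fun ω _ => ?_
          split_ifs with hω
          · exact sub_le_self _ (sum_nonneg fun j _ => h0 j ω)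
          · simpa [G] using hω
      _ = ∑ xx with F xx ∈ G, (P xx).toReal := by
          rw [← sum_filter, filter_mem_eq_inter, univ_inter, PMF.sum_map_toReal]
      _ ≤ ∑ xx with xx.1 ∈ univ.filter fun x => e x ∈ S, (P xx).toReal := by
          refine sum_le_sum_of_subset_of_nonneg (fun xx hxx => ?_)
            fun _ _ _ => ENNReal.toReal_nonneg
          have hlt : ∑ j, q j (F xx) < (P.map F (F xx)).toReal := by simpa [G] using hxx
          have hrow := fun j => hL j _ (F xx) rfl hlt
          simp only [mem_filter, mem_univ, true_and]
          refine ⟨e xx.2, fun i => ?_, ?_⟩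
          · simpa [F, blocksAndExtractor] using hrow i.castSucc
          · simpa [F, blocksAndExtractor] using hrow (Fin.last ℓ)
      _ = ∑ x with e x ∈ S, (P.map Prod.fst x).toReal := by rw [PMF.sum_map_toReal]
      _ ≤ ∑ x with e x ∈ S, (2 : ℝ) ^ (-κ) := sum_le_sum fun x _ => hP x
      _ = (2 : ℝ) ^ (-κ) * S.ncard := by
          rw [sum_const, nsmul_eq_mul, mul_comm]
          congr 2
          rw [Set.ncard_eq_toFinset_card']
          exact card_bijective e e.bijective (by simp)
  refine hmass.trans (mul_le_mul_of_nonneg_left ?_ (by positivity))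
  refine hS.trans_eq ?_
  simp

theorem condenser_error_le {ℓ N A M : ℕ} (hℓ : 0 < ℓ) {β σ c : ℝ} (hσ : 0 < σ)
    (hβ : β * (ℓ * (ℓ + 2)) = σ) (hc : 8 * σ * ℓ ≤ c) (hM : 8 * σ * ℓ * N ≤ (min M N : ℕ))
    (hN : 1 ≤ β * (ℓ * N)) :
    (2 : ℝ) ^ (-((1 - β) * (ℓ * N))) * (((2 : ℝ) ^ N) ^ ℓ *
      (ℓ * ((2 : ℝ) ^ (β * N) / (⌈(2 : ℝ) ^ (4 * σ * N)⌉₊ : ℕ)) +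
        (⌈(2 : ℝ) ^ (4 * σ * N)⌉₊ : ℕ) ^ ℓ *
          ((2 : ℝ) ^ (-(c * (N + A : ℕ))) +
            (2 : ℝ) ^ (β * N) * 2 ^ (-((min M N : ℕ) : ℝ))))) ≤
      (2 : ℝ) ^ (-(σ / ℓ * (ℓ * N))) := by
  have hℓ1 : (1 : ℝ) ≤ ℓ := by exact_mod_cast hℓ
  have hN0 : (0 : ℝ) ≤ N := Nat.cast_nonneg N
  have hβ0 : 0 < β := by
    by_contra! h
    nlinarith [mul_nonneg (by linarith : (0 : ℝ) ≤ ℓ) hN0]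
  have hβσ : β * (ℓ + 1) ≤ σ := by
    rw [← hβ]
    exact mul_le_mul_of_nonneg_left (by nlinarith) hβ0.le
  have hσN : (ℓ : ℝ) + 2 ≤ σ * N := by
    have : σ * N = β * (ℓ * N) * (ℓ + 2) := by rw [← hβ]; ring
    nlinarith
  set D : ℕ := ⌈(2 : ℝ) ^ (4 * σ * N)⌉₊
  have hD1 : (2 : ℝ) ^ (4 * σ * N) ≤ D := Nat.le_ceil _
  have hD2 : (D : ℝ) ≤ 2 ^ (4 * σ * N + 1) := by
    have h1 : (D : ℝ) < 2 ^ (4 * σ * N) + 1 := Nat.ceil_lt_add_one (by positivity)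
    have h2 : (1 : ℝ) ≤ 2 ^ (4 * σ * N) := Real.one_le_rpow (by norm_num) (by positivity)
    rw [Real.rpow_add (by norm_num), Real.rpow_one]
    linarith
  have hmono : ∀ {x y : ℝ}, x ≤ y → (2 : ℝ) ^ x ≤ 2 ^ y := fun h =>
    Real.rpow_le_rpow_of_exponent_le (by norm_num) h
  have hpre : (2 : ℝ) ^ (-((1 - β) * (ℓ * N))) * ((2 : ℝ) ^ N) ^ ℓ = 2 ^ (β * ℓ * N) := by
    rw [← pow_mul, ← Real.rpow_natCast, ← Real.rpow_add (by norm_num)]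
    congr 1
    push_cast
    ring
  have hfirst : (2 : ℝ) ^ (β * ℓ * N) * ((2 : ℝ) ^ (β * N) / D) ≤ 2 ^ (-(3 * σ * N)) := by
    calc (2 : ℝ) ^ (β * ℓ * N) * ((2 : ℝ) ^ (β * N) / D)
        ≤ (2 : ℝ) ^ (β * ℓ * N) * ((2 : ℝ) ^ (β * N) / 2 ^ (4 * σ * N)) := by gcongr
      _ = 2 ^ (β * ℓ * N + (β * N - 4 * σ * N)) := by
          rw [Real.rpow_add (by norm_num), Real.rpow_sub (by norm_num)]
      _ ≤ _ := hmono (by nlinarith)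
  have hsum : (2 : ℝ) ^ (-(c * (N + A : ℕ))) + (2 : ℝ) ^ (β * N) * 2 ^ (-((min M N : ℕ) : ℝ)) ≤
      2 ^ (β * N - 8 * σ * ℓ * N + 1) := by
    rw [Real.rpow_add (by norm_num) _ 1, Real.rpow_one, mul_two, ← Real.rpow_add (by norm_num)]
    have hc0 : 0 ≤ c := le_trans (by positivity) hc
    have hA : (0 : ℝ) ≤ A := Nat.cast_nonneg A
    refine add_le_add (hmono ?_) (hmono (by linarith))
    push_cast
    nlinarith [mul_nonneg hc0 hA, mul_nonneg hβ0.le hN0, mul_le_mul_of_nonneg_right hc hN0]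
  have hsecond : (2 : ℝ) ^ (β * ℓ * N) * (D ^ ℓ * ((2 : ℝ) ^ (-(c * (N + A : ℕ))) +
      (2 : ℝ) ^ (β * N) * 2 ^ (-((min M N : ℕ) : ℝ)))) ≤ 2 ^ (-(3 * σ * N) + (ℓ + 1)) := by
    calc (2 : ℝ) ^ (β * ℓ * N) * (D ^ ℓ * ((2 : ℝ) ^ (-(c * (N + A : ℕ))) +
          (2 : ℝ) ^ (β * N) * 2 ^ (-((min M N : ℕ) : ℝ))))
        ≤ (2 : ℝ) ^ (β * ℓ * N) * (((2 : ℝ) ^ (4 * σ * N + 1)) ^ ℓ *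
            2 ^ (β * N - 8 * σ * ℓ * N + 1)) := by gcongr
      _ = 2 ^ (β * ℓ * N + ((4 * σ * N + 1) * ℓ + (β * N - 8 * σ * ℓ * N + 1))) := by
          rw [← Real.rpow_mul_natCast (by norm_num), ← Real.rpow_add (by norm_num),
            ← Real.rpow_add (by norm_num)]
      _ ≤ _ := by
          apply hmono
          have h1 : β * (ℓ + 1) * N ≤ σ * N := mul_le_mul_of_nonneg_right hβσ hN0
          have h2 : 1 * (σ * N) ≤ ℓ * (σ * N) := by gcongr
          linarith
  have hℓ2 : (ℓ : ℝ) ≤ 2 ^ ((ℓ : ℝ) + 1) := by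
    have : ℓ ≤ 2 ^ (ℓ + 1) := (Nat.lt_two_pow_self.trans (Nat.pow_lt_pow_succ one_lt_two)).le
    have h : ((2 : ℝ) ^ ((ℓ : ℝ) + 1)) = ((2 ^ (ℓ + 1) : ℕ) : ℝ) := by
      rw [← Nat.cast_add_one, Real.rpow_natCast]
      push_cast
      rfl
    rw [h]
    exact_mod_cast this
  rw [← mul_assoc, hpre, mul_add, mul_left_comm]
  calc _ ≤ (ℓ : ℝ) * 2 ^ (-(3 * σ * N)) + 2 ^ (-(3 * σ * N) + (ℓ + 1)) := by gcongr
    _ ≤ 2 ^ ((ℓ : ℝ) + 1) * 2 ^ (-(3 * σ * N)) + 2 ^ (-(3 * σ * N) + (ℓ + 1)) := by gcongr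
    _ = 2 ^ (-(3 * σ * N) + (ℓ + 1) + 1) := by
        rw [← Real.rpow_add (by norm_num), add_comm ((ℓ : ℝ) + 1), ← mul_two,
          Real.rpow_add (by norm_num) _ 1, Real.rpow_one]
    _ ≤ _ := by
        apply hmono
        have : σ / ℓ * (ℓ * N) = σ * N := by field_simp
        rw [this]
        linarith [mul_nonneg hσ.le hN0]

/-- Splitting a bit string into `ℓ` blocks of equal length. -/
def splitBlocks (ℓ N : ℕ) : Bits (ℓ * N) ≃ (Fin ℓ → Bits N) :=
  (Equiv.arrowCongr finProdFinEquiv.symm (Equiv.refl Bool)).trans (Equiv.curry _ _ _)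

end Condenser

/-- If for some constants `ℓ, γ, α, c` there is (for every `n`) an `ℓ`-source
non-malleable extractor for min-entropy `(1-γ)n` with output length `≥ α n` and error
`2^{-cn}`, then there are constants `β, c' > 0` such that for every `n` divisible by `ℓ`
there is a `((1-β)n, β(n/ℓ), 2^{-c'n})` non-malleable somewhere condenser with advice
`advSRcond : {0,1}^n × {0,1}^{⌊βn⌋} → ({0,1}^{n/ℓ})^{ℓ+1}`. -/
theorem stmt_15 (ℓ : ℕ) (hℓ : 0 < ℓ) (γ α c : ℝ) (hγ : γ > 0) (hα : α > 0) (hc : c > 0)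
    (m : ℕ → ℕ)
    (hhyp : ∀ n : ℕ, (m n : ℝ) ≥ α * n ∧
      ∃ nmExt : (Fin ℓ → Bits n) → Bits (m n),
        IsLSourceNMExt ((1 - γ) * n) ((2 : ℝ) ^ (-(c * n))) nmExt) :
    ∃ β c' : ℝ, β > 0 ∧ c' > 0 ∧
      ∀ n : ℕ, ℓ ∣ n →
        ∃ advSRcond : Bits n → Bits ⌊β * n⌋₊ → Fin (ℓ + 1) → Bits (n / ℓ),
          IsNMSomewhereCondenser ((1 - β) * n) (β * ((n / ℓ : ℕ) : ℝ))
            ((2 : ℝ) ^ (-(c' * n))) advSRcond := by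
  have hℓ1 : (1 : ℝ) ≤ ℓ := by exact_mod_cast hℓ
  have hℓ0 : (0 : ℝ) < ℓ := by linarith
  set σ : ℝ := min (min c (min α 1) / (8 * ℓ)) γ
  have hσ0 : 0 < σ := by positivity
  have hσκ : 8 * σ * ℓ ≤ min c (min α 1) := by
    have : σ ≤ min c (min α 1) / (8 * ℓ) := min_le_left _ _
    rw [le_div_iff₀ (by positivity)] at this
    linarith
  have hσγ : σ ≤ γ := min_le_right _ _
  have hσc : 8 * σ * ℓ ≤ c := hσκ.trans (min_le_left _ _)
  have hσα : 8 * σ * ℓ ≤ α := hσκ.trans ((min_le_right _ _).trans (min_le_left _ _))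
  have hσ1 : 8 * σ * ℓ ≤ 1 := hσκ.trans ((min_le_right _ _).trans (min_le_right _ _))
  set β : ℝ := σ / (ℓ * (ℓ + 2))
  have hβ0 : 0 < β := by positivity
  have hβσ : β * (ℓ * (ℓ + 2)) = σ := div_mul_cancel₀ _ (by positivity)
  have hβℓ : β * ℓ ≤ σ := by
    rw [← hβσ]
    exact mul_le_mul_of_nonneg_left (by nlinarith) hβ0.le
  refine ⟨β, σ / ℓ, hβ0, by positivity, ?_⟩
  rintro _ ⟨N, rfl⟩
  rw [Nat.mul_div_cancel_left N hℓ]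
  set A := ⌊β * (ℓ * N : ℕ)⌋₊
  obtain ⟨hm, nmExt, hext⟩ := hhyp (N + A)
  have hN0 : (0 : ℝ) ≤ N := Nat.cast_nonneg N
  have hAle : (A : ℝ) ≤ γ * N := by
    refine (Nat.floor_le (by positivity)).trans ?_
    push_cast
    rw [← mul_assoc]
    exact mul_le_mul_of_nonneg_right (hβℓ.trans hσγ) hN0
  have hA0 : (0 : ℝ) ≤ A := Nat.cast_nonneg A
  refine ⟨blocksAndExtractor (splitBlocks ℓ N) nmExt, fun P hP a b hab => ?_⟩
  have hApos : 1 ≤ β * (ℓ * N) := by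
    have : 0 < A := by
      by_contra! h
      refine hab (funext fun i => absurd i.2 (by omega))
    have := Nat.floor_pos.mp this
    push_cast at this
    exact this
  have hk : (1 - γ) * (N + A : ℕ) ≤ (N : ℝ) := by
    push_cast
    nlinarith [mul_nonneg hγ.le hA0]
  have hk' : β * N ≤ (N : ℝ) := by
    have : β ≤ 1 := by nlinarith
    nlinarith
  have hM : 8 * σ * ℓ * N ≤ (min (m (N + A)) N : ℕ) := by
    push_cast at hm ⊢
    refine le_min ?_ ?_
    · refine le_trans ?_ hm
      nlinarith [mul_nonneg hα.le hA0, mul_le_mul_of_nonneg_right hσα hN0]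
    · nlinarith
  obtain ⟨J, wp, Q, hQ, hsd⟩ := sd_blocksAndExtractor_le hℓ
    (Nat.ceil_pos.mpr (by positivity : (0 : ℝ) < 2 ^ (4 * σ * N))) hext hk hk'
    (splitBlocks ℓ N) P hP hab
  refine ⟨J, wp, Q, hQ, hsd.trans ?_⟩
  rw [Nat.cast_mul]
  exact condenser_error_le hℓ hσ0 hβσ hσc hM hApos
end

section
/- There exist constants β>0 and c'>0 such that for every n∈ℕ divisible by 10 there exists a ((1−β)n, β·(n/10), 2^{−c'n}) non-malleable somewhere condenser with advice advSRcond : {0,1}^n × {0,1}^{⌊βn⌋} → ({0,1}^{n/10})^{11}. (Explicitness/efficient computability is omitted; only existence is asserted.) -/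
open scoped ENNReal

section Counting

open Classical in
/-- Exponential moment bound for the number of coordinates of a uniformly random function
which land in a fixed set. -/
theorem card_filter_le_card_preimage_mul {X R : Type*} [Fintype X] [Fintype R]
    (S : Finset R) (K : ℕ) :
    (Finset.univ.filter fun h : X → R => K ≤ (Finset.univ.filter fun x => h x ∈ S).card).card
      * 2 ^ K ≤ (Fintype.card R + S.card) ^ Fintype.card X := by
  have key : ∑ h : X → R, 2 ^ (Finset.univ.filter fun x => h x ∈ S).card
      = (Fintype.card R + S.card) ^ Fintype.card X := by
    have h1 : ∀ h : X → R, 2 ^ (Finset.univ.filter fun x => h x ∈ S).card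
        = ∏ x, (1 + if h x ∈ S then 1 else 0) := by
      intro h
      rw [← Finset.prod_const, Finset.prod_filter]
      refine Finset.prod_congr rfl fun x _ => ?_
      split_ifs <;> rfl
    simp_rw [h1]
    rw [← Fintype.piFinset_univ, ← Finset.prod_univ_sum (fun _ : X => (Finset.univ : Finset R))
      (fun _ r => 1 + if r ∈ S then 1 else 0)]
    simp [Finset.sum_add_distrib]
  rw [← key, ← smul_eq_mul, ← Finset.sum_const]
  refine (Finset.sum_le_sum fun h hh => ?_).trans
    (Finset.sum_le_sum_of_subset (Finset.filter_subset _ _))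
  exact Nat.pow_le_pow_right (by norm_num) (Finset.mem_filter.1 hh).2

open Classical in
theorem card_filter_two_coordinates_mul_le {D H : Type*} [Fintype D] [Fintype H]
    {i k : D} (hik : i ≠ k) (B : H → H → Prop) [DecidableRel B] (b : ℕ)
    (hb : ∀ g, (Finset.univ.filter fun h => B h g).card ≤ b) :
    (Finset.univ.filter fun F : D → H => B (F i) (F k)).card * Fintype.card H
      ≤ b * Fintype.card (D → H) := by
  have h1 : (Finset.univ.filter fun F : D → H => B (F i) (F k)).card
      = ∑ g : {d // d ≠ i} → H, (Finset.univ.filter fun h => B h (g ⟨k, hik.symm⟩)).card := by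
    rw [Finset.card_filter, ← (Equiv.funSplitAt i H).symm.sum_comp, Fintype.sum_prod_type_right]
    refine Finset.sum_congr rfl fun g _ => ?_
    rw [Finset.card_filter]
    refine Finset.sum_congr rfl fun h _ => ?_
    simp [Equiv.funSplitAt, Equiv.piSplitAt, hik.symm]
  have h2 : Fintype.card (D → H) = Fintype.card H * Fintype.card ({d // d ≠ i} → H) := by
    rw [Fintype.card_congr (Equiv.funSplitAt i H), Fintype.card_prod]
  rw [h1, h2, mul_left_comm, mul_comm, mul_comm b]
  refine Nat.mul_le_mul_left _ ((Finset.sum_le_sum fun g _ => hb _).trans ?_)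
  simp

open Classical in
/-- The points of `T → B` that some list-valued product map `G` assigns to a value of `g`. -/
theorem card_list_image_le {X T B : Type*} [Fintype X] [Fintype T] [Fintype B]
    (g : X → T → B) (G : T → B → Finset B) (L : ℕ) (hG : ∀ j z, (G j z).card ≤ L) :
    (Finset.univ.filter fun r : T → B => ∃ x', ∀ j, r j ∈ G j (g x' j)).card
      ≤ Fintype.card X * L ^ Fintype.card T := by
  have h : (Finset.univ.filter fun r : T → B => ∃ x', ∀ j, r j ∈ G j (g x' j))
      = Finset.univ.biUnion fun x' => Fintype.piFinset fun j => G j (g x' j) := by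
    ext r; simp
  rw [h]
  refine Finset.card_biUnion_le_card_mul _ _ _ fun x' _ => ?_
  rw [Fintype.card_piFinset]
  exact (Finset.prod_le_pow_card _ _ _ fun j _ => hG _ _).trans_eq rfl

open Classical in
/-- Existence, by counting, of a family of functions no member of which agrees often with a
short-list-valued product map of another member. -/
theorem exists_list_nonmalleable_family {D X T B : Type*} [Fintype D] [Fintype X] [Fintype T]
    [Fintype B] [Nonempty B] (K L : ℕ)
    (hcard : Fintype.card (D × D × (T → B → Finset B))
        * (Fintype.card (T → B) + Fintype.card X * L ^ Fintype.card T) ^ Fintype.card X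
      < 2 ^ K * Fintype.card (T → B) ^ Fintype.card X) :
    ∃ F : D → X → T → B, ∀ i k, i ≠ k → ∀ G : T → B → Finset B, (∀ j z, (G j z).card ≤ L) →
      (Finset.univ.filter fun x => ∃ x', ∀ j, F i x j ∈ G j (F k x' j)).card < K := by
  by_contra! hcon
  let bad : D × D × (T → B → Finset B) → Finset (D → X → T → B) := fun q =>
    Finset.univ.filter fun F => q.1 ≠ q.2.1 ∧ (∀ j z, (q.2.2 j z).card ≤ L) ∧
      K ≤ (Finset.univ.filter fun x => ∃ x', ∀ j, F q.1 x j ∈ q.2.2 j (F q.2.1 x' j)).card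
  set M := (Fintype.card (T → B) + Fintype.card X * L ^ Fintype.card T) ^ Fintype.card X with hM
  set A := Fintype.card (D → X → T → B)
  have hbad : ∀ q, (bad q).card * (2 ^ K * Fintype.card (X → T → B)) ≤ M * A := by
    rintro ⟨i, k, G⟩
    by_cases hq : i ≠ k ∧ ∀ j z, (G j z).card ≤ L
    · have hfix : ∀ g : X → T → B, (Finset.univ.filter fun h : X → T → B =>
          K ≤ (Finset.univ.filter fun x => ∃ x', ∀ j, h x j ∈ G j (g x' j)).card).card
            ≤ M / 2 ^ K := by
        intro g
        rw [Nat.le_div_iff_mul_le (by positivity)]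
        have := card_filter_le_card_preimage_mul (X := X)
          (Finset.univ.filter fun r : T → B => ∃ x', ∀ j, r j ∈ G j (g x' j)) K
        simp only [Finset.mem_filter, Finset.mem_univ, true_and] at this
        exact this.trans (Nat.pow_le_pow_left
          (Nat.add_le_add_left (card_list_image_le g G L hq.2) _) _)
      have h2 := card_filter_two_coordinates_mul_le hq.1 (fun h g : X → T → B =>
        K ≤ (Finset.univ.filter fun x => ∃ x', ∀ j, h x j ∈ G j (g x' j)).card) _ hfix
      have h3 : bad (i, k, G) = Finset.univ.filter fun F : D → X → T → B =>
          K ≤ (Finset.univ.filter fun x => ∃ x', ∀ j, F i x j ∈ G j (F k x' j)).card := by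
        ext F
        simp only [bad, Finset.mem_filter, Finset.mem_univ, true_and]
        exact ⟨fun h => h.2.2, fun h => ⟨hq.1, hq.2, h⟩⟩
      rw [h3]
      calc _ = 2 ^ K * (_ * Fintype.card (X → T → B)) := by rw [mul_left_comm]
        _ ≤ 2 ^ K * (M / 2 ^ K * A) := Nat.mul_le_mul_left _ h2
        _ = M / 2 ^ K * 2 ^ K * A := by ring
        _ ≤ M * A := Nat.mul_le_mul_right _ (Nat.div_mul_le_self _ _)
    · have : bad (i, k, G) = ∅ := by
        refine Finset.filter_eq_empty_iff.2 fun F _ h => hq ⟨h.1, h.2.1⟩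
      simp [this]
  have hcover : (Finset.univ : Finset (D → X → T → B)) ⊆ Finset.univ.biUnion bad := by
    intro F _
    obtain ⟨i, k, hik, G, hG, hK⟩ := hcon F
    exact Finset.mem_biUnion.2 ⟨(i, k, G), Finset.mem_univ _,
      Finset.mem_filter.2 ⟨Finset.mem_univ _, hik, hG, hK⟩⟩
  have hA : A ≤ ∑ q, (bad q).card := (Finset.card_le_card hcover).trans Finset.card_biUnion_le
  have hApos : 0 < A := Fintype.card_pos
  have : A * (2 ^ K * Fintype.card (X → T → B))
      ≤ Fintype.card (D × D × (T → B → Finset B)) * M * A := by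
    calc _ ≤ (∑ q, (bad q).card) * (2 ^ K * Fintype.card (X → T → B)) :=
          Nat.mul_le_mul_right _ hA
      _ ≤ ∑ _q : D × D × (T → B → Finset B), M * A := by
          rw [Finset.sum_mul]; exact Finset.sum_le_sum fun q _ => hbad q
      _ = _ := by rw [Finset.sum_const, smul_eq_mul, Finset.card_univ, mul_assoc]
  rw [mul_comm _ A] at this
  have h5 := Nat.le_of_mul_le_mul_left this hApos
  rw [Fintype.card_fun (α := X)] at h5
  exact absurd hcard (not_lt.2 h5)

theorem one_add_inv_pow_le (q c : ℕ) (hq : 0 < q) : (q + 1) ^ (q * c) ≤ 4 ^ c * q ^ (q * c) := by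
  have hq' : (0 : ℝ) < q := by exact_mod_cast hq
  have h1 : ((1 : ℝ) / q + 1) ^ q ≤ 4 := by
    calc ((1 : ℝ) / q + 1) ^ q ≤ (Real.exp (1 / q)) ^ q :=
          pow_le_pow_left₀ (by positivity) (Real.add_one_le_exp _) _
      _ = Real.exp 1 := by rw [← Real.exp_nat_mul, mul_one_div_cancel hq'.ne']
      _ ≤ 4 := by linarith [Real.exp_one_lt_d9]
  have h2 : ((q : ℝ) + 1) ^ q ≤ 4 * (q : ℝ) ^ q := by
    calc ((q : ℝ) + 1) ^ q = ((1 : ℝ) / q + 1) ^ q * (q : ℝ) ^ q := by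
          rw [← mul_pow]; congr 1; field_simp; ring
      _ ≤ _ := mul_le_mul_of_nonneg_right h1 (by positivity)
  have h3 : (q + 1) ^ q ≤ 4 * q ^ q := by exact_mod_cast h2
  rw [pow_mul, pow_mul, ← mul_pow]
  exact Nat.pow_le_pow_left h3 _

theorem exists_list_nonmalleable_bits (m a e : ℕ) (he : 1000 * e ≤ m) (he1 : 1 ≤ e)
    (ha : a ≤ m) :
    ∃ F : Bits a → Bits (10 * m) → Fin 11 → Bits m, ∀ i k, i ≠ k →
      ∀ G : Fin 11 → Bits m → Finset (Bits m), (∀ j z, (G j z).card ≤ 2 ^ (2 * e)) →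
      {x | ∃ x', ∀ j, F i x j ∈ G j (F k x' j)}.ncard ≤ 2 ^ (10 * m - 100 * e) := by
  classical
  obtain ⟨F, hF⟩ := exists_list_nonmalleable_family (D := Bits a) (X := Bits (10 * m))
    (T := Fin 11) (B := Bits m) (2 ^ (10 * m - 100 * e)) (2 ^ (2 * e)) (by
      simp only [Fintype.card_prod, Fintype.card_fun, Fintype.card_finset, Fintype.card_fin,
        Fintype.card_bool]
      obtain ⟨d, rfl⟩ := Nat.exists_eq_add_of_le he
      set m := 1000 * e + d with hm
      have hq := one_add_inv_pow_le (2 ^ (m - 22 * e)) (2 ^ (9 * m + 22 * e)) (by positivity)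
      have e1 : 2 ^ (m - 22 * e) * 2 ^ (9 * m + 22 * e) = 2 ^ (10 * m) := by
        rw [← pow_add]; congr 1; omega
      rw [e1] at hq
      have e2 : (2 ^ m) ^ 11 = 2 ^ (10 * m + 22 * e) * 2 ^ (m - 22 * e) := by
        rw [← pow_mul, ← pow_add]; congr 1; omega
      have e3 : 2 ^ (10 * m) * (2 ^ (2 * e)) ^ 11 = 2 ^ (10 * m + 22 * e) := by
        rw [← pow_mul, ← pow_add]; congr 1; omega
      rw [e3, e2]
      have e4 : 2 ^ (10 * m + 22 * e) * 2 ^ (m - 22 * e) + 2 ^ (10 * m + 22 * e)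
        = 2 ^ (10 * m + 22 * e) * (2 ^ (m - 22 * e) + 1) := by ring
      rw [e4, mul_pow _ (2 ^ (m - 22 * e) + 1), mul_pow _ (2 ^ (m - 22 * e))]
      set U := (2 ^ (10 * m + 22 * e)) ^ 2 ^ (10 * m)
      set V := (2 ^ (m - 22 * e)) ^ 2 ^ (10 * m)
      have hU : 0 < U := by positivity
      have hV : 0 < V := by positivity
      have e5 : 2 ^ a * (2 ^ a * ((2 ^ 2 ^ m) ^ 2 ^ m) ^ 11) * 4 ^ 2 ^ (9 * m + 22 * e)
          < 2 ^ 2 ^ (10 * m - 100 * e) := by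
        rw [show (4 : ℕ) = 2 ^ 2 by norm_num]
        simp only [← pow_mul, ← pow_add]
        refine Nat.pow_lt_pow_right (by norm_num) ?_
        have f1 : a ≤ 2 ^ (9 * m + 22 * e) := by
          refine ha.trans (Nat.lt_two_pow_self.le.trans (Nat.pow_le_pow_right (by norm_num) ?_))
          omega
        have f2 : 2 ^ (m + m) ≤ 2 ^ (9 * m + 22 * e) :=
          Nat.pow_le_pow_right (by norm_num) (by omega)
        have f3 : 2 ^ (9 * m + 22 * e + 4) ≤ 2 ^ (10 * m - 100 * e) :=
          Nat.pow_le_pow_right (by norm_num) (by omega)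
        have f4 : 0 < 2 ^ (9 * m + 22 * e) := by positivity
        rw [pow_add _ _ 4] at f3
        have f5 : 2 ^ (m + m) * 11 ≤ 2 ^ (9 * m + 22 * e) * 11 := Nat.mul_le_mul_right _ f2
        generalize 2 ^ (9 * m + 22 * e) = c at *
        generalize 2 ^ (m + m) = c' at *
        omega
      calc _ ≤ 2 ^ a * (2 ^ a * ((2 ^ 2 ^ m) ^ 2 ^ m) ^ 11)
              * (U * (4 ^ 2 ^ (9 * m + 22 * e) * V)) := by gcongr
        _ = (2 ^ a * (2 ^ a * ((2 ^ 2 ^ m) ^ 2 ^ m) ^ 11) * 4 ^ 2 ^ (9 * m + 22 * e))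
              * (U * V) := by ring
        _ < _ := Nat.mul_lt_mul_of_pos_right e5 (by positivity))
  refine ⟨F, fun i k hik G hG => ?_⟩
  have h := hF i k hik G hG
  rw [← Set.ncard_coe_finset] at h
  simpa using h.le

end Counting

section Splitting

open Classical in
/-- The total weight under `w` of the points satisfying `φ`. -/
noncomputable def weight {A : Type*} [Fintype A] (w : A → ℝ) (φ : A → Prop) : ℝ :=
  ∑ a, if φ a then w a else 0

variable {A : Type*} [Fintype A] {w : A → ℝ}

theorem weight_nonneg (hw : ∀ a, 0 ≤ w a) (φ : A → Prop) : 0 ≤ weight w φ :=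
  Finset.sum_nonneg fun a _ => by split_ifs <;> simp [hw a]

theorem weight_mono (hw : ∀ a, 0 ≤ w a) {φ ψ : A → Prop} (h : ∀ a, φ a → ψ a) :
    weight w φ ≤ weight w ψ := by
  refine Finset.sum_le_sum fun a _ => ?_
  by_cases h1 : φ a
  · simp [h1, h a h1]
  · simp only [h1, if_false]; split_ifs <;> simp [hw a]

theorem weight_eq_zero {φ : A → Prop} (h : ∀ a, ¬ φ a) : weight w φ = 0 :=
  Finset.sum_eq_zero fun a _ => by simp [h a]

open Classical in
theorem weight_exists_le {ι : Type*} [Fintype ι] (hw : ∀ a, 0 ≤ w a) (φ : ι → A → Prop) :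
    weight w (fun a => ∃ i, φ i a) ≤ ∑ i, weight w (φ i) := by
  unfold weight
  rw [Finset.sum_comm]
  refine Finset.sum_le_sum fun a _ => ?_
  have hn : ∀ i ∈ Finset.univ, 0 ≤ if φ i a then w a else 0 := fun i _ => by
    split_ifs <;> simp [hw a]
  split_ifs with h
  · obtain ⟨i, hi⟩ := h
    refine le_trans ?_ (Finset.single_le_sum hn (Finset.mem_univ i))
    simp [hi]
  · exact Finset.sum_nonneg hn

theorem weight_or_le (hw : ∀ a, 0 ≤ w a) (φ ψ : A → Prop) :
    weight w (fun a => φ a ∨ ψ a) ≤ weight w φ + weight w ψ := by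
  unfold weight
  rw [← Finset.sum_add_distrib]
  refine Finset.sum_le_sum fun a _ => ?_
  have := hw a
  by_cases h1 : φ a <;> by_cases h2 : ψ a <;> simp [h1, h2, this]

theorem sum_weight_fiber {B : Type*} [Fintype B] (φ : A → Prop) (v : A → B) :
    ∑ z, weight w (fun a => φ a ∧ v a = z) = weight w φ := by
  classical
  unfold weight
  rw [Finset.sum_comm]
  refine Finset.sum_congr rfl fun a _ => ?_
  by_cases h : φ a <;> simp [h]

/-- Splitting a weighted family of pairs of rows. Up to weight `t * δ`, and up to the points for
which every row `u j` lies in a short list determined by `v j`, the points can be split into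
parts, the `j`-th of which has `u j` spread out given `v j`. -/
theorem exists_row_splitting {t : ℕ} {B : Type*} [Fintype B] (hw : ∀ a, 0 ≤ w a)
    (hw1 : ∑ a, w a ≤ 1) (u v : Fin t → A → B) {θ δ : ℝ} (hθ : 0 < θ) (hδ : 0 < δ) :
    ∃ (idx : A → Option (Fin t)) (G : Fin t → B → Finset B),
      (∀ j z, (G j z).card * θ ≤ 1) ∧
      (∀ j z y, weight w (fun a => idx a = some j ∧ u j a = y ∧ v j a = z)
        ≤ θ / δ * weight w (fun a => idx a = some j ∧ v j a = z)) ∧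
      weight w (fun a => idx a = none)
        ≤ t * δ + weight w (fun a => ∀ j, u j a ∈ G j (v j a)) := by
  classical
  let W : Fin t → B → ℝ := fun j z => weight w fun a => v j a = z
  have hW : ∀ j z, 0 ≤ W j z := fun j z => weight_nonneg hw _
  let G : Fin t → B → Finset B := fun j z =>
    Finset.univ.filter fun y => θ * W j z < weight w fun a => v j a = z ∧ u j a = y
  have hC : ∀ a, ∃ c : Option (Fin t), (∀ j, c = some j → u j a ∉ G j (v j a)) ∧
      (c = none → ∀ j, u j a ∈ G j (v j a)) := by
    intro a
    by_cases h : ∃ j, u j a ∉ G j (v j a)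
    · obtain ⟨j, hj⟩ := h
      exact ⟨some j, by rintro i hi; cases hi; exact hj, by simp⟩
    · push Not at h
      exact ⟨none, by simp, fun _ => h⟩
  choose C hC1 hC2 using hC
  let good : Fin t → B → Prop := fun j z =>
    δ * W j z ≤ weight w fun a => C a = some j ∧ v j a = z
  let idx : A → Option (Fin t) := fun a =>
    (C a).bind fun j => if good j (v j a) then some j else none
  have hidx : ∀ a j, idx a = some j ↔ C a = some j ∧ good j (v j a) := by
    intro a j
    simp only [idx, Option.bind_eq_some_iff]
    constructor
    · rintro ⟨i, hi, h⟩
      split_ifs at h with hg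
      cases h
      exact ⟨hi, hg⟩
    · rintro ⟨hi, hg⟩
      exact ⟨j, hi, by simp [hg]⟩
  refine ⟨idx, G, fun j z => ?_, fun j z y => ?_, ?_⟩
  · have h1 : ((G j z).card : ℝ) * (θ * W j z) ≤ W j z := by
      calc ((G j z).card : ℝ) * (θ * W j z) = ∑ y ∈ G j z, θ * W j z := by simp
        _ ≤ ∑ y ∈ G j z, weight w fun a => v j a = z ∧ u j a = y :=
            Finset.sum_le_sum fun y hy => (Finset.mem_filter.1 hy).2.le
        _ ≤ ∑ y, weight w fun a => v j a = z ∧ u j a = y :=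
            Finset.sum_le_sum_of_subset_of_nonneg (Finset.subset_univ _)
              fun y _ _ => weight_nonneg hw _
        _ = W j z := sum_weight_fiber _ _
    rcases (hW j z).eq_or_lt with h0 | h0
    · have : G j z = ∅ := by
        refine Finset.filter_eq_empty_iff.2 fun y _ => ?_
        rw [← h0, mul_zero, not_lt, h0]
        exact weight_mono hw fun a h => h.1
      simp [this]
    · rw [← mul_assoc] at h1
      exact le_of_mul_le_mul_right (h1.trans_eq (one_mul _).symm) h0
  · have hR : 0 ≤ θ / δ * weight w (fun a => idx a = some j ∧ v j a = z) :=
      mul_nonneg (by positivity) (weight_nonneg hw _)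
    by_cases hg : good j z
    · by_cases hy : y ∈ G j z
      · rw [weight_eq_zero]
        · exact hR
        · rintro a ⟨h1, rfl, rfl⟩
          exact hC1 a j ((hidx a j).1 h1).1 hy
      · have hy' : (weight w fun a => v j a = z ∧ u j a = y) ≤ θ * W j z := by
          simpa [G] using hy
        calc _ ≤ weight w (fun a => v j a = z ∧ u j a = y) :=
              weight_mono hw fun a h => ⟨h.2.2, h.2.1⟩
          _ ≤ θ * W j z := hy'
          _ = θ / δ * (δ * W j z) := by field_simp
          _ ≤ θ / δ * weight w (fun a => C a = some j ∧ v j a = z) :=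
              mul_le_mul_of_nonneg_left hg (by positivity)
          _ ≤ _ := by
              refine mul_le_mul_of_nonneg_left (weight_mono hw ?_) (by positivity)
              rintro a ⟨h1, rfl⟩
              exact ⟨(hidx a j).2 ⟨h1, hg⟩, rfl⟩
    · rw [weight_eq_zero]
      · exact hR
      · rintro a ⟨h1, -, rfl⟩
        exact hg ((hidx a j).1 h1).2
  · have hsplit : weight w (fun a => idx a = none)
        ≤ weight w (fun a => (∃ q : Fin t × B, (C a = some q.1 ∧ v q.1 a = q.2) ∧
            ¬ good q.1 q.2) ∨ ∀ j, u j a ∈ G j (v j a)) := by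
      refine weight_mono hw fun a ha => ?_
      rcases hc : C a with _ | j
      · exact Or.inr (hC2 a hc)
      · refine Or.inl ⟨(j, v j a), ⟨rfl, rfl⟩, fun hg => ?_⟩
        rw [(hidx a j).2 ⟨hc, hg⟩] at ha
        cases ha
    refine hsplit.trans ((weight_or_le hw _ _).trans (add_le_add_left ?_ _))
    refine (weight_exists_le hw _).trans ?_
    rw [Fintype.sum_prod_type]
    have hj : ∀ j : Fin t, ∑ z, weight w (fun a => (C a = some j ∧ v j a = z) ∧ ¬ good j z)
        ≤ δ := by
      intro j
      calc _ ≤ ∑ z, δ * W j z := by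
            refine Finset.sum_le_sum fun z _ => ?_
            by_cases hg : good j z
            · rw [weight_eq_zero fun a h => h.2 hg]
              exact mul_nonneg hδ.le (hW j z)
            · exact (weight_mono hw fun a h => h.1).trans (not_le.1 hg).le
        _ = δ * ∑ z, weight w (fun a => True ∧ v j a = z) := by
            rw [← Finset.mul_sum]; simp [W]
        _ ≤ δ := by
            rw [sum_weight_fiber]
            refine mul_le_of_le_one_right hδ.le ?_
            simpa [weight] using hw1
    exact (Finset.sum_le_sum fun j _ => hj j).trans_eq (by simp)

end Splitting

section Distributions

variable {A S : Type*} [Fintype A] [Fintype S]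

theorem sum_toReal_eq_one (p : PMF A) : ∑ a, (p a).toReal = 1 := by
  rw [← ENNReal.toReal_sum fun a _ => p.apply_ne_top a, ← tsum_fintype (L := .unconditional A),
    p.tsum_coe, ENNReal.toReal_one]

theorem toReal_map_apply {S : Type*} (p : PMF A) (f : A → S) (s : S) :
    (p.map f s).toReal = weight (fun a => (p a).toReal) fun a => f a = s := by
  classical
  rw [PMF.map_apply, tsum_fintype, ENNReal.toReal_sum]
  · refine Finset.sum_congr rfl fun a _ => ?_
    by_cases h : f a = s
    · simp [h]
    · simp [h, Ne.symm h]
  · intro a _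
    split_ifs <;> simp [p.apply_ne_top a]

theorem toReal_pr_map (p : PMF A) (f : A → S) (φ : S → Prop) :
    (pr (p.map f) φ).toReal = weight (fun a => (p a).toReal) fun a => φ (f a) := by
  classical
  rw [pr, ENNReal.toReal_sum]
  · rw [← sum_weight_fiber _ f]
    refine Finset.sum_congr rfl fun s _ => ?_
    by_cases h : φ s
    · rw [if_pos h, toReal_map_apply]
      congr 1
      funext a
      exact propext ⟨fun e => ⟨e ▸ h, e⟩, fun e => e.2⟩
    · rw [if_neg h, weight_eq_zero]
      · simp
      · rintro a ⟨h1, rfl⟩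
        exact h h1
  · intro s _
    split_ifs
    · exact PMF.apply_ne_top _ _
    · simp

theorem weight_filter (p : PMF A) (s : Set A) (h : ∃ a ∈ s, a ∈ p.support) (φ : A → Prop) :
    weight (fun a => (p.filter s h a).toReal) φ
      = weight (fun a => (p a).toReal) (fun a => a ∈ s ∧ φ a)
        * (weight (fun a => (p a).toReal) fun a => a ∈ s)⁻¹ := by
  classical
  have hc : (∑' a, s.indicator p a).toReal = weight (fun a => (p a).toReal) fun a => a ∈ s := by
    rw [tsum_fintype, ENNReal.toReal_sum]
    · refine Finset.sum_congr rfl fun a _ => ?_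
      by_cases ha : a ∈ s <;> simp [ha]
    · intro a _
      by_cases ha : a ∈ s <;> simp [ha, p.apply_ne_top a]
  rw [← hc]
  simp only [weight, Finset.sum_mul]
  refine Finset.sum_congr rfl fun a _ => ?_
  rw [PMF.filter_apply, ENNReal.toReal_mul, ENNReal.toReal_inv]
  by_cases ha : a ∈ s <;> by_cases hφ : φ a <;> simp [ha, hφ]

theorem sum_toReal_le_one (p : PMF A) (T : Finset A) : ∑ a ∈ T, (p a).toReal ≤ 1 :=
  (Finset.sum_le_sum_of_subset_of_nonneg (Finset.subset_univ T)
    fun _ _ _ => ENNReal.toReal_nonneg).trans_eq (sum_toReal_eq_one p)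

/-- Replacing one component of the disintegration of `p.map f` along `idx` moves the distribution
by at most the weight of that component. -/
theorem sd_map_bind_le {J : Type*} [Fintype J] (p : PMF A) (f : A → S) (idx : A → J) (j₀ : J)
    (Q : J → PMF S)
    (hQ : ∀ j, j ≠ j₀ → ∀ s, (p.map idx j).toReal * (Q j s).toReal
      = weight (fun a => (p a).toReal) fun a => f a = s ∧ idx a = j) :
    sd (p.map f) ((p.map idx).bind Q) ≤ weight (fun a => (p a).toReal) fun a => idx a = j₀ := by
  classical
  set w : A → ℝ := fun a => (p a).toReal
  have hw : ∀ a, 0 ≤ w a := fun a => ENNReal.toReal_nonneg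
  refine ciSup_le fun T => ?_
  have h1 : ∑ s ∈ T, (p.map f s).toReal
      = ∑ j, ∑ s ∈ T, weight w fun a => f a = s ∧ idx a = j := by
    rw [Finset.sum_comm]
    exact Finset.sum_congr rfl fun s _ => by rw [toReal_map_apply, sum_weight_fiber]
  have h2 : ∑ s ∈ T, ((p.map idx).bind Q s).toReal
      = ∑ j, ∑ s ∈ T, (p.map idx j).toReal * (Q j s).toReal := by
    rw [Finset.sum_comm]
    refine Finset.sum_congr rfl fun s _ => ?_
    rw [PMF.bind_apply, tsum_fintype, ENNReal.toReal_sum]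
    · simp only [ENNReal.toReal_mul]
    · exact fun j _ => ENNReal.mul_ne_top (PMF.apply_ne_top _ _) (PMF.apply_ne_top _ _)
  have h3 : ∑ s ∈ T, (p.map f s).toReal - ∑ s ∈ T, ((p.map idx).bind Q s).toReal
      = ∑ s ∈ T, (weight w fun a => f a = s ∧ idx a = j₀)
        - (p.map idx j₀).toReal * ∑ s ∈ T, (Q j₀ s).toReal := by
    rw [h1, h2, ← Finset.sum_sub_distrib, Finset.sum_eq_single j₀, Finset.mul_sum]
    · intro j _ hj
      rw [sub_eq_zero]
      exact Finset.sum_congr rfl fun s _ => (hQ j hj s).symm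
    · simp
  have h4 : ∑ s ∈ T, (weight w fun a => f a = s ∧ idx a = j₀)
      ≤ weight w fun a => idx a = j₀ := by
    rw [← sum_weight_fiber (w := w) (fun a => idx a = j₀) f]
    simp_rw [and_comm]
    exact Finset.sum_le_sum_of_subset_of_nonneg (Finset.subset_univ T)
      fun s _ _ => weight_nonneg hw _
  have h5 : 0 ≤ ∑ s ∈ T, (weight w fun a => f a = s ∧ idx a = j₀) :=
    Finset.sum_nonneg fun s _ => weight_nonneg hw _
  have h6 : 0 ≤ (p.map idx j₀).toReal * ∑ s ∈ T, (Q j₀ s).toReal := by positivity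
  have h7 := mul_le_of_le_one_right (weight_nonneg hw fun a => idx a = j₀)
    (sum_toReal_le_one (Q j₀) T)
  rw [h3, abs_le, toReal_map_apply] at *
  constructor <;> linarith

/-- The component over `j` of the disintegration of `p.map f` along `idx`. -/
theorem toReal_map_mul_filter {S J : Type*} (p : PMF A) (f : A → S) (idx : A → J) (j : J)
    (h : ∃ a ∈ {a | idx a = j}, a ∈ p.support) (s : S) :
    (p.map idx j).toReal * ((p.filter {a | idx a = j} h).map f s).toReal
      = weight (fun a => (p a).toReal) fun a => f a = s ∧ idx a = j := by
  have hpos : (p.map idx j).toReal ≠ 0 := by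
    obtain ⟨a, ha, hp⟩ := h
    refine ENNReal.toReal_ne_zero.2 ⟨?_, PMF.apply_ne_top _ _⟩
    exact (PMF.mem_support_iff _ _).1 ((PMF.mem_support_map_iff _ _ _).2 ⟨a, hp, ha⟩)
  rw [toReal_map_apply _ f, weight_filter, toReal_map_apply] at *
  simp only [Set.mem_ofPred_eq, and_comm (b := idx _ = j)]
  field_simp

theorem weight_fst_mem_le {X Y : Type*} [Fintype X] [Fintype Y] (p : PMF (X × Y)) {k : ℝ}
    (hk : minEntropyGe (p.map Prod.fst) k) (V : Set X) :
    weight (fun a => (p a).toReal) (fun a => a.1 ∈ V) ≤ V.ncard * (2 : ℝ) ^ (-k) := by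
  classical
  have h1 : weight (fun a => (p a).toReal) (fun a => a.1 ∈ V)
      ≤ ∑ x : V, weight (fun a => (p a).toReal) fun a => a.1 = x := by
    refine (weight_mono (fun _ => ENNReal.toReal_nonneg) ?_).trans
      (weight_exists_le (fun _ => ENNReal.toReal_nonneg) _)
    exact fun a ha => ⟨⟨a.1, ha⟩, rfl⟩
  refine h1.trans ?_
  calc _ ≤ ∑ _x : V, (2 : ℝ) ^ (-k) :=
        Finset.sum_le_sum fun x _ => by rw [← toReal_map_apply]; exact hk x
    _ = _ := by simp [Set.ncard_eq_toFinset_card']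

theorem exists_nmSomewhereProperty {m t : ℕ} (j : Fin t) {k' : ℝ} (hk' : k' ≤ m) :
    ∃ Q : PMF ((Fin t → Bits m) × (Fin t → Bits m)), NMSomewhereProperty k' Q := by
  refine ⟨(PMF.uniformOfFintype (Bits m)).map fun y => (fun _ => y, fun _ _ => false),
    j, fun z x => ?_⟩
  rw [toReal_pr_map, toReal_pr_map]
  by_cases hz : (fun _ => false) = z
  · have h2 : (2 : ℝ) ^ (-(m : ℝ)) ≤ 2 ^ (-k') :=
      Real.rpow_le_rpow_of_exponent_le (by norm_num) (by linarith)
    rw [Real.rpow_neg (by norm_num), Real.rpow_natCast] at h2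
    simpa [hz, weight] using h2
  · simp [hz, weight]

theorem isNMSomewhereCondenser_of_list {n a m t : ℕ} (j₀ : Fin t) {k k' ε δ : ℝ} {K L : ℕ}
    (F : Bits n → Bits a → Fin t → Bits m)
    (hF : ∀ α α', α ≠ α' → ∀ G : Fin t → Bits m → Finset (Bits m),
      (∀ j z, (G j z).card ≤ L) → {x | ∃ x', ∀ j, F x α j ∈ G j (F x' α' j)}.ncard ≤ K)
    (hL : 0 < L) (hδ : 0 < δ) (hk' : k' ≤ m) (hLδ : (L : ℝ)⁻¹ / δ ≤ 2 ^ (-k'))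
    (hε : t * δ + K * (2 : ℝ) ^ (-k) ≤ ε) :
    IsNMSomewhereCondenser k k' ε F := by
  classical
  intro p hp α α' hα
  set f : Bits n × Bits n → (Fin t → Bits m) × (Fin t → Bits m) :=
    fun xx => (F xx.1 α, F xx.2 α')
  set w : Bits n × Bits n → ℝ := fun a => (p a).toReal
  have hw : ∀ a, 0 ≤ w a := fun a => ENNReal.toReal_nonneg
  have hL' : (0 : ℝ) < L := by exact_mod_cast hL
  obtain ⟨idx, G, hG, hrow, hnone⟩ := exists_row_splitting hw (sum_toReal_eq_one p).le
    (fun j a => (f a).1 j) (fun j a => (f a).2 j) (inv_pos.2 hL') hδ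
  obtain ⟨U, hU⟩ := exists_nmSomewhereProperty j₀ hk'
  let Q : Option (Fin t) → PMF ((Fin t → Bits m) × (Fin t → Bits m)) := fun o =>
    if o = none then U
    else if h : ∃ a ∈ {a | idx a = o}, a ∈ p.support then (p.filter _ h).map f else U
  have hsupp : ∀ o, o ∈ (p.map idx).support → ∃ a ∈ {a | idx a = o}, a ∈ p.support := by
    intro o ho
    obtain ⟨a, ha, h⟩ := (PMF.mem_support_map_iff _ _ _).1 ho
    exact ⟨a, h, ha⟩
  refine ⟨Option (Fin t), p.map idx, Q, fun o ho => ?_, ?_⟩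
  · rcases o with _ | j
    · simpa [Q] using hU
    · have hj := hsupp _ ho
      have hQ : Q (some j) = (p.filter _ hj).map f := by
        simp only [Q, reduceCtorEq, if_false]
        rw [dif_pos hj]
      refine ⟨j, fun z x => ?_⟩
      rw [hQ, toReal_pr_map, toReal_pr_map, weight_filter, weight_filter, ← mul_assoc]
      refine mul_le_mul_of_nonneg_right ((hrow j z x).trans ?_)
        (inv_nonneg.2 (weight_nonneg hw _))
      exact mul_le_mul_of_nonneg_right hLδ (weight_nonneg hw _)
  · refine (sd_map_bind_le p f idx none Q fun o ho s => ?_).trans (hnone.trans (le_trans ?_ hε))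
    · by_cases h : ∃ a ∈ {a | idx a = o}, a ∈ p.support
      · have hQ : Q o = (p.filter _ h).map f := by
          simp only [Q, if_neg ho]
          rw [dif_pos h]
        rw [hQ, toReal_map_mul_filter]
      · have h0 : (p.map idx o).toReal = 0 := by
          rw [(PMF.apply_eq_zero_iff _ _).2 fun ho => h (hsupp o ho), ENNReal.toReal_zero]
        refine le_antisymm ?_ ?_
        · rw [h0, zero_mul]; exact weight_nonneg hw _
        · rw [h0, zero_mul, ← h0, toReal_map_apply]
          exact weight_mono hw fun a ha => ha.2
    · refine add_le_add_right ?_ _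
      have hV := weight_fst_mem_le p hp {x | ∃ x', ∀ j, F x α j ∈ G j (F x' α' j)}
      refine (weight_mono hw ?_).trans (hV.trans ?_)
      · exact fun a ha => ⟨a.2, ha⟩
      · refine mul_le_mul_of_nonneg_right ?_ (by positivity)
        refine Nat.cast_le.2 (hF α α' hα G fun j z => ?_)
        have := hG j z
        rw [mul_inv_le_iff₀ hL', one_mul] at this
        exact_mod_cast this

end Distributions

/-- There are constants `β, c' > 0` such that for every `n` divisible by `10` there is
a `((1-β)n, β(n/10), 2^{-c'n})` non-malleable somewhere condenser with advice
`advSRcond : {0,1}^n × {0,1}^{⌊βn⌋} → ({0,1}^{n/10})^{11}`. -/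
theorem stmt_16 :
    ∃ β c' : ℝ, β > 0 ∧ c' > 0 ∧
      ∀ n : ℕ, 10 ∣ n →
        ∃ advSRcond : Bits n → Bits ⌊β * n⌋₊ → Fin 11 → Bits (n / 10),
          IsNMSomewhereCondenser ((1 - β) * n) (β * ((n / 10 : ℕ) : ℝ))
            ((2 : ℝ) ^ (-(c' * n))) advSRcond := by
  refine ⟨1 / 100000, 1 / 200000, by norm_num, by norm_num, ?_⟩
  rintro _ ⟨m, rfl⟩
  rw [Nat.mul_div_cancel_left m (by norm_num : 0 < 10)]
  by_cases hm : m < 10000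
  · have h0 : ⌊(1 / 100000 : ℝ) * (10 * m : ℕ)⌋₊ = 0 := by
      rw [Nat.floor_eq_zero]
      have : (m : ℝ) < 10000 := by exact_mod_cast hm
      push_cast
      linarith
    rw [h0]
    exact ⟨fun _ _ _ _ => false, fun _ _ αa αb h => absurd (Subsingleton.elim αa αb) h⟩
  · have ha : ⌊(1 / 100000 : ℝ) * (10 * m : ℕ)⌋₊ ≤ m := by
      refine Nat.floor_le_of_le ?_
      push_cast
      linarith [(Nat.cast_nonneg m : (0 : ℝ) ≤ m)]
    set e := m / 1000 with he
    have he1 : 1000 * e ≤ m := Nat.mul_div_le m 1000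
    have he2 : m < 1000 * (e + 1) := by omega
    have he3 : 10 ≤ e := by omega
    obtain ⟨F, hF⟩ := exists_list_nonmalleable_bits m _ e he1 (by omega) ha
    have r1 : (1000 : ℝ) * e ≤ m := by exact_mod_cast he1
    have r2 : (m : ℝ) < 1000 * (e + 1) := by exact_mod_cast he2
    have r3 : (10 : ℝ) ≤ e := by exact_mod_cast he3
    refine ⟨fun x α => F α x, isNMSomewhereCondenser_of_list (0 : Fin 11) (δ := 2 ^ (-(e : ℝ)))
      (K := 2 ^ (10 * m - 100 * e)) (L := 2 ^ (2 * e)) _ hF (by positivity) (by positivity)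
      ?_ ?_ ?_⟩
    · linarith
    · have : (((2 ^ (2 * e) : ℕ) : ℝ))⁻¹ = (2 : ℝ) ^ (-(2 * e : ℝ)) := by
        rw [Real.rpow_neg (by norm_num)]
        congr 1
        rw [Nat.cast_pow, ← Real.rpow_natCast]
        push_cast
        rfl
      rw [this, ← Real.rpow_sub (by norm_num)]
      exact Real.rpow_le_rpow_of_exponent_le (by norm_num) (by linarith)
    · have hK : ((2 ^ (10 * m - 100 * e) : ℕ) : ℝ)
          * (2 : ℝ) ^ (-((1 - 1 / 100000) * ((10 * m : ℕ) : ℝ))) ≤ 2 ^ (-(e : ℝ)) := by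
        have : ((2 ^ (10 * m - 100 * e) : ℕ) : ℝ) = (2 : ℝ) ^ (10 * m - 100 * e : ℝ) := by
          rw [Nat.cast_pow, ← Real.rpow_natCast, Nat.cast_sub (by omega)]
          push_cast
          rfl
        rw [this, ← Real.rpow_add (by norm_num)]
        refine Real.rpow_le_rpow_of_exponent_le (by norm_num) ?_
        push_cast
        linarith
      calc _ ≤ (11 : ℕ) * (2 : ℝ) ^ (-(e : ℝ)) + 2 ^ (-(e : ℝ)) := add_le_add_right hK _
        _ ≤ (2 : ℝ) ^ (4 : ℝ) * 2 ^ (-(e : ℝ)) := by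
          have : (0 : ℝ) < 2 ^ (-(e : ℝ)) := by positivity
          have h4 : (2 : ℝ) ^ (4 : ℝ) = 16 := by norm_num
          rw [h4]
          push_cast
          linarith
        _ ≤ _ := by
          rw [← Real.rpow_add (by norm_num)]
          refine Real.rpow_le_rpow_of_exponent_le (by norm_num) ?_
          push_cast
          linarith
end
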